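/- arXiv:2407.20096 — 12 statements merged into one kernel-verified Lean document; each statement's English description precedes it below -/
import Mathlib

section
/- Let Y be a linear subspace of 𝒟ₙ and let {A₁, …, A_m} and {B₁, …, B_m} be two bases of Y, with A_k having diagonal (a(k,1),…,a(k,n)) and B_k having diagonal (b(k,1),…,b(k,n)). Then for every i ∈ {1,…,n}, the i-th component satisfies the *-Property with respect to the family (a(k,j)) if and only if the i-th component satisfies the *-Property with respect to the family (b(k,j)). -/
/-- The operator norm of an `n × n` real matrix, induced by the Euclidean norm on `ℝⁿ`. -/
noncomputable def opNorm {n : ℕ} (A : Matrix (Fin n) (Fin n) ℝ) : ℝ :=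
  ‖LinearMap.toContinuousLinearMap (Matrix.toEuclideanLin A)‖

/-- The `i`-th component of the family of diagonals `a`. -/
def comp {m n : ℕ} (a : Fin m → Fin n → ℝ) (i : Fin n) : Fin m → ℝ := fun k => a k i

/-- The positively associated set of the `i`-th component. -/
def Pplus {m n : ℕ} (a : Fin m → Fin n → ℝ) (i : Fin n) : Set (Fin n) :=
  {j | comp a j = comp a i}

/-- The negatively associated set of the `i`-th component. -/
def Pminus {m n : ℕ} (a : Fin m → Fin n → ℝ) (i : Fin n) : Set (Fin n) :=
  {j | comp a j = -comp a i}

/-- `Sᵢ = Pᵢ⁺ ∪ Pᵢ⁻`. -/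
def Sset {m n : ℕ} (a : Fin m → Fin n → ℝ) (i : Fin n) : Set (Fin n) :=
  Pplus a i ∪ Pminus a i

/-- The `i`-th component satisfies the `*`-Property. -/
def StarProperty {m n : ℕ} (a : Fin m → Fin n → ℝ) (i : Fin n) : Prop :=
  ∃ β : Fin m → ℝ, (∑ k, β k * a k i) ≠ 0 ∧
    ∀ j ∉ Sset a i, |∑ k, β k * a k j| < |∑ k, β k * a k i|

/-- Components `i` and `j` are equivalent if `v_j = ± vᵢ`. -/
def EquivComp {m n : ℕ} (a : Fin m → Fin n → ℝ) (i j : Fin n) : Prop :=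
  comp a j = comp a i ∨ comp a j = -comp a i

/-- Diagonals whose matrices lie in the span of the family `b` are linear combinations of the
members of `b`. -/
lemma exists_coeff_of_diagonal_mem_span {m n : ℕ} {b : Fin m → Fin n → ℝ} {d : Fin n → ℝ}
    (h : Matrix.diagonal d ∈ Submodule.span ℝ (Set.range fun k => Matrix.diagonal (b k))) :
    ∃ c : Fin m → ℝ, ∀ j, d j = ∑ k, c k * b k j := by
  obtain ⟨c, hc⟩ := (Submodule.mem_span_range_iff_exists_fun ℝ).1 h
  refine ⟨c, fun j => ?_⟩
  have := congrFun (congrFun hc j) j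
  simpa [Matrix.sum_apply] using this.symm

lemma Sset_subset_of_eq_sum {m n : ℕ} {a b : Fin m → Fin n → ℝ} {c : Fin m → Fin m → ℝ}
    (h : ∀ k j, b k j = ∑ l, c k l * a l j) (i : Fin n) : Sset a i ⊆ Sset b i := by
  rintro j (hj | hj)
  · refine Or.inl (funext fun k => ?_)
    have hl : ∀ l, a l j = a l i := fun l => congrFun hj l
    simp [comp, h, hl]
  · refine Or.inr (funext fun k => ?_)
    have hl : ∀ l, a l j = -a l i := fun l => congrFun hj l
    simp [comp, h, hl]

lemma StarProperty.of_span_eq {m n : ℕ} {a b : Fin m → Fin n → ℝ}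
    (hspan : Submodule.span ℝ (Set.range fun k => Matrix.diagonal (a k)) =
        Submodule.span ℝ (Set.range fun k => Matrix.diagonal (b k)))
    {i : Fin n} (hi : StarProperty a i) : StarProperty b i := by
  obtain ⟨β, hne, hlt⟩ := hi
  have hmem : Matrix.diagonal (fun j => ∑ k, β k * a k j) ∈
      Submodule.span ℝ (Set.range fun k => Matrix.diagonal (b k)) := by
    rw [← hspan]
    refine (Submodule.mem_span_range_iff_exists_fun ℝ).2 ⟨β, ?_⟩
    ext p q
    by_cases hpq : p = q
    · subst hpq
      simp [Matrix.sum_apply]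
    · simp [Matrix.sum_apply, hpq]
  obtain ⟨γ, hγ⟩ := exists_coeff_of_diagonal_mem_span hmem
  choose c hc using fun k => exists_coeff_of_diagonal_mem_span
    (hspan ▸ Submodule.subset_span ⟨k, rfl⟩ :
      Matrix.diagonal (b k) ∈ Submodule.span ℝ (Set.range fun k => Matrix.diagonal (a k)))
  refine ⟨γ, by rwa [← hγ], fun j hj => ?_⟩
  rw [← hγ, ← hγ]
  exact hlt j fun hja => hj (Sset_subset_of_eq_sum hc i hja)

/-- The `*`-Property does not depend on the choice of basis of the subspace of diagonal
matrices. -/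
theorem starProperty_basis_invariant (m n : ℕ) (a b : Fin m → Fin n → ℝ)
    (ha : LinearIndependent ℝ fun k => Matrix.diagonal (a k))
    (hb : LinearIndependent ℝ fun k => Matrix.diagonal (b k))
    (hspan : Submodule.span ℝ (Set.range fun k => Matrix.diagonal (a k)) =
        Submodule.span ℝ (Set.range fun k => Matrix.diagonal (b k))) :
    ∀ i : Fin n, StarProperty a i ↔ StarProperty b i := by
  exact fun i => ⟨StarProperty.of_span_eq hspan, StarProperty.of_span_eq hspan.symm⟩
end

section
/- Let A₁, …, A_m be linearly independent diagonal matrices in 𝒟ₙ, with A_k having diagonal (a(k,1),…,a(k,n)). Then there exists i ∈ {1,…,n} such that the i-th component satisfies the *-Property. -/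
/-- The sum of the squares of two distinct vectors strictly dominates twice their dot product. -/
theorem two_mul_sum_mul_lt_of_ne {ι : Type*} [Fintype ι] {v w : ι → ℝ} (h : v ≠ w) :
    2 * ∑ k, v k * w k < ∑ k, v k ^ 2 + ∑ k, w k ^ 2 := by
  obtain ⟨k, hk⟩ := Function.ne_iff.mp h
  have hpos : 0 < ∑ k, (v k - w k) ^ 2 :=
    Finset.sum_pos' (fun _ _ => sq_nonneg _)
      ⟨k, Finset.mem_univ k, sq_pos_iff.mpr (sub_ne_zero.mpr hk)⟩
  have hexp : ∑ k, (v k - w k) ^ 2 =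
      ∑ k, v k ^ 2 + ∑ k, w k ^ 2 - 2 * ∑ k, v k * w k := by
    rw [Finset.mul_sum, ← Finset.sum_add_distrib, ← Finset.sum_sub_distrib]
    exact Finset.sum_congr rfl fun _ _ => by ring
  linarith

/-- There always exists a component satisfying the `*`-Property. -/
theorem exists_starProperty (m n : ℕ) (hm : 0 < m) (hn : 0 < n)
    (a : Fin m → Fin n → ℝ)
    (ha : LinearIndependent ℝ fun k => Matrix.diagonal (a k)) :
    ∃ i : Fin n, StarProperty a i := by
  have : Nonempty (Fin n) := ⟨⟨0, hn⟩⟩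
  obtain ⟨i, hi⟩ := Finite.exists_max fun j => ∑ k, a k j ^ 2
  have hpos : 0 < ∑ k, a k i ^ 2 := by
    have hne : a ⟨0, hm⟩ ≠ 0 := fun h => ha.ne_zero ⟨0, hm⟩ (by simp [h])
    obtain ⟨j, hj⟩ := Function.ne_iff.mp hne
    refine lt_of_lt_of_le ?_ (hi j)
    exact Finset.sum_pos' (fun _ _ => sq_nonneg _)
      ⟨⟨0, hm⟩, Finset.mem_univ _, sq_pos_iff.mpr hj⟩
  have hself : ∑ k, a k i * a k i = ∑ k, a k i ^ 2 :=
    Finset.sum_congr rfl fun _ _ => (sq _).symm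
  refine ⟨i, comp a i, (hself.trans_ne hpos.ne' :), fun j hj => ?_⟩
  change |∑ k, a k i * a k j| < |∑ k, a k i * a k i|
  rw [hself, abs_of_pos hpos, abs_lt]
  have hplus : comp a i ≠ comp a j := fun h => hj (Or.inl h.symm)
  have hminus : comp a i ≠ -comp a j := fun h => hj (Or.inr (by simp [Pminus, h]))
  have h₁ := two_mul_sum_mul_lt_of_ne hplus
  have h₂ := two_mul_sum_mul_lt_of_ne hminus
  have hj' := hi j
  simp only [comp, Pi.neg_apply, mul_neg, Finset.sum_neg_distrib, even_two.neg_pow] at h₁ h₂ hj'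
  constructor <;> linarith
end

section
/- Let A₁, …, A_m be linearly independent diagonal matrices in 𝒟ₙ, with A_k having diagonal (a(k,1),…,a(k,n)). Then for every β₁, …, β_m ∈ ℝ there exists i ∈ {1,…,n} such that the i-th component satisfies the *-Property and ‖Σ_k β_k A_k‖ = |Σ_k β_k a(k,i)|, where ‖·‖ is the operator norm on Mₙ. -/
open scoped Matrix.Norms.L2Operator in
/-- The operator norm of a real diagonal matrix is the sup norm of its diagonal. -/
theorem opNorm_diagonal {n : ℕ} (d : Fin n → ℝ) : opNorm (Matrix.diagonal d) = ‖d‖ :=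
  Matrix.l2_opNorm_diagonal d

theorem opNorm_sum_smul_diagonal {m n : ℕ} (a : Fin m → Fin n → ℝ) (β : Fin m → ℝ) :
    opNorm (∑ k, β k • Matrix.diagonal (a k)) = ‖fun j => ∑ k, β k * a k j‖ := by
  rw [← opNorm_diagonal]
  congr 1
  ext i j
  by_cases h : i = j <;> simp [Matrix.sum_apply, h]

/-- The sum `Σₖ a(k,i) a(k,j)` is strictly dominated by `|vᵢ|²` when `|vⱼ| ≤ |vᵢ|` and
`vⱼ ≠ ±vᵢ`. -/
theorem abs_sum_mul_lt_of_notMem_Sset {m n : ℕ} (a : Fin m → Fin n → ℝ) {i j : Fin n}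
    (hj : j ∉ Sset a i) (hle : ∑ k, a k j * a k j ≤ ∑ k, a k i * a k i) :
    |∑ k, a k i * a k j| < ∑ k, a k i * a k i := by
  have hsq : ∀ c : ℝ, (∃ k, a k j + c * a k i ≠ 0) →
      0 < ∑ k, (a k j + c * a k i) ^ 2 := fun c ⟨k, hk⟩ =>
    Finset.sum_pos' (fun _ _ => sq_nonneg _) ⟨k, Finset.mem_univ k, by positivity⟩
  have hexp : ∀ c : ℝ, ∑ k, (a k j + c * a k i) ^ 2 =
      ∑ k, a k j * a k j + 2 * c * ∑ k, a k i * a k j + c ^ 2 * ∑ k, a k i * a k i := by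
    intro c
    simp only [Finset.mul_sum, ← Finset.sum_add_distrib]
    exact Finset.sum_congr rfl fun k _ => by ring
  have hplus : 0 < ∑ k, (a k j + (-1) * a k i) ^ 2 := by
    refine hsq _ ?_
    by_contra! h
    exact hj (Or.inl (funext fun k => by simp only [comp]; linarith [h k]))
  have hminus : 0 < ∑ k, (a k j + 1 * a k i) ^ 2 := by
    refine hsq _ ?_
    by_contra! h
    exact hj (Or.inr (funext fun k => by simp only [comp, Pi.neg_apply]; linarith [h k]))
  rw [hexp] at hplus hminus
  rw [abs_lt]
  constructor <;> linarith

open Filter Topology in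
/-- A component which is maximal in absolute value at `β`, and has the largest Euclidean length
among all such components, satisfies the `*`-Property: moving `β` slightly in the direction
`±vᵢ` makes it strictly dominant. -/
theorem starProperty_of_maximal {m n : ℕ} (a : Fin m → Fin n → ℝ) (β : Fin m → ℝ) {i : Fin n}
    (hmax : ∀ j, |∑ k, β k * a k j| ≤ |∑ k, β k * a k i|)
    (hlen : ∀ j, |∑ k, β k * a k j| = |∑ k, β k * a k i| →
      ∑ k, a k j * a k j ≤ ∑ k, a k i * a k i)
    (hpos : 0 < ∑ k, a k i * a k i) : StarProperty a i := by
  obtain ⟨σ, hσ, hσi⟩ : ∃ σ : ℝ, |σ| = 1 ∧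
      ∑ k, β k * a k i = σ * |∑ k, β k * a k i| := by
    rcases le_total 0 (∑ k, β k * a k i) with h | h
    · exact ⟨1, by simp, by rw [abs_of_nonneg h, one_mul]⟩
    · exact ⟨-1, by simp, by rw [abs_of_nonpos h]; ring⟩
  have hsum : ∀ (t : ℝ) j, ∑ k, (β k + t * σ * a k i) * a k j =
      ∑ k, β k * a k j + t * σ * ∑ k, a k i * a k j := by
    intro t j
    rw [Finset.mul_sum, ← Finset.sum_add_distrib]
    exact Finset.sum_congr rfl fun k _ => by ring
  have hev : ∀ j, ∀ᶠ t : ℝ in 𝓝[>] 0, j ∉ Sset a i →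
      |∑ k, β k * a k j| + t * |∑ k, a k i * a k j| <
        |∑ k, β k * a k i| + t * ∑ k, a k i * a k i := by
    intro j
    rcases (hmax j).lt_or_eq with h | h
    · have hlim : ∀ᶠ t : ℝ in 𝓝 0, |∑ k, β k * a k j| + t * |∑ k, a k i * a k j| <
          |∑ k, β k * a k i| + t * ∑ k, a k i * a k i :=
        ContinuousAt.eventually_lt (by fun_prop) (by fun_prop) (by simpa using h)
      filter_upwards [nhdsWithin_le_nhds hlim] with t ht _ using ht
    · filter_upwards [self_mem_nhdsWithin] with t ht hj
      rw [h]
      have := mul_lt_mul_of_pos_left (abs_sum_mul_lt_of_notMem_Sset a hj (hlen j h)) ht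
      gcongr
  obtain ⟨t, ht, htpos⟩ := ((eventually_all.2 hev).and self_mem_nhdsWithin).exists
  replace htpos : 0 < t := htpos
  have hi : |∑ k, (β k + t * σ * a k i) * a k i| =
      |∑ k, β k * a k i| + t * ∑ k, a k i * a k i := by
    rw [hsum]
    conv_lhs => rw [hσi]
    rw [show ∀ x y : ℝ, σ * x + t * σ * y = σ * (x + t * y) by intros; ring, abs_mul, hσ, one_mul,
      abs_of_nonneg (by positivity)]
  refine ⟨fun k => β k + t * σ * a k i, ?_, fun j hj => ?_⟩
  · rw [← abs_pos, hi]
    positivity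
  · rw [hi, hsum]
    refine (abs_add_le _ _).trans_lt ?_
    rw [abs_mul, abs_mul, hσ, mul_one, abs_of_pos htpos]
    exact ht j hj

/-- For any scalars `β`, the operator norm of `Σ βₖ Aₖ` is attained at a component
satisfying the `*`-Property. -/
theorem opNorm_attained_at_starProperty_component (m n : ℕ) (hm : 0 < m) (hn : 0 < n)
    (a : Fin m → Fin n → ℝ)
    (ha : LinearIndependent ℝ fun k => Matrix.diagonal (a k)) :
    ∀ β : Fin m → ℝ, ∃ i : Fin n, StarProperty a i ∧
      opNorm (∑ k, β k • Matrix.diagonal (a k)) = |∑ k, β k * a k i| := by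
  intro β
  have : Nonempty (Fin n) := ⟨⟨0, hn⟩⟩
  obtain ⟨i₀, hi₀⟩ := Finite.exists_max fun j => |∑ k, β k * a k j|
  obtain ⟨i, hiJ, hi⟩ := Set.exists_max_image
    {j | |∑ k, β k * a k j| = |∑ k, β k * a k i₀|} (fun j => ∑ k, a k j * a k j)
    (Set.toFinite _) ⟨i₀, rfl⟩
  replace hiJ : |∑ k, β k * a k i| = |∑ k, β k * a k i₀| := hiJ
  have hmax : ∀ j, |∑ k, β k * a k j| ≤ |∑ k, β k * a k i| := fun j => hiJ ▸ hi₀ j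
  have hlen : ∀ j, |∑ k, β k * a k j| = |∑ k, β k * a k i| →
      ∑ k, a k j * a k j ≤ ∑ k, a k i * a k i := fun j hj => hi j (hj.trans hiJ)
  refine ⟨i, starProperty_of_maximal a β hmax hlen ?_, ?_⟩
  · have eq_zero : ∀ j, ∑ k, a k j * a k j ≤ 0 → ∀ k, a k j = 0 := fun j hj k =>
      mul_self_eq_zero.1 ((Finset.sum_eq_zero_iff_of_nonneg fun k _ => mul_self_nonneg (a k j)).1
        (hj.antisymm (Finset.sum_nonneg fun k _ => mul_self_nonneg (a k j))) k (Finset.mem_univ k))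
    by_contra! h
    have hβ : |∑ k, β k * a k i| = 0 := by simp [eq_zero i h]
    refine ha.ne_zero ⟨0, hm⟩ (Matrix.diagonal_eq_zero.2 (funext fun j => ?_))
    exact eq_zero j ((hlen j (le_antisymm (hmax j) (hβ ▸ abs_nonneg _))).trans h) _
  · rw [opNorm_sum_smul_diagonal]
    exact le_antisymm ((pi_norm_le_iff_of_nonneg (abs_nonneg _)).2 hmax)
      (norm_le_pi_norm (fun j => ∑ k, β k * a k j) i)
end

section
/- Let A₁, …, A_m be linearly independent diagonal matrices in 𝒟ₙ, with A_k having diagonal (a(k,1),…,a(k,n)). Fix i, j ∈ {1,…,n} with j ∉ Sᵢ. Then there exists a normal cone K ⊆ ℝᵐ such that interior(K) ∪ interior(−K) = { β ∈ ℝᵐ : |Σ_k β_k a(k,j)| < |Σ_k β_k a(k,i)| }. -/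
/-- A nonempty set `K ⊆ ℝᵐ` is a normal cone. -/
def IsNormalCone {m : ℕ} (K : Set (Fin m → ℝ)) : Prop :=
  K.Nonempty ∧ (∀ u ∈ K, ∀ v ∈ K, u + v ∈ K) ∧
    (∀ u ∈ K, ∀ α : ℝ, 0 ≤ α → α • u ∈ K) ∧ K ∩ (-K) = {0}

open scoped Topology Pointwise in
/-- Adjoining the origin to an open set disjoint from its reflection does not change its
interior. -/
theorem interior_insert_zero_of_disjoint_neg {E : Type*} [NormedAddCommGroup E]
    [NormedSpace ℝ E] [Nontrivial E] {U : Set E} (hU : IsOpen U) (hdisj : Disjoint U (-U)) :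
    interior (insert 0 U) = U := by
  refine subset_antisymm (fun x hx => ?_)
    (hU.subset_interior_iff.2 (Set.subset_insert 0 U))
  obtain rfl | hxU := interior_subset hx
  · exfalso
    have h : insert 0 U ∈ 𝓝 (0 : E) := mem_interior_iff_mem_nhds.1 hx
    have hneg : -insert 0 U ∈ 𝓝 (0 : E) := by
      simpa using neg_mem_nhds_zero E h
    have hsingleton : ({0} : Set E) ∈ 𝓝 (0 : E) := by
      filter_upwards [h, hneg] with y hy hy'
      rcases hy with hy | hy
      · exact hy
      rcases hy' with hy' | hy'
      · exact neg_eq_zero.1 hy'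
      · exact (Set.disjoint_left.1 hdisj hy hy').elim
    have := Module.punctured_nhds_neBot ℝ E (0 : E)
    have hmem := mem_interior_iff_mem_nhds.2 hsingleton
    rw [interior_singleton] at hmem
    exact hmem
  · exact hxU

open scoped Pointwise in
/-- The points where a linear functional `f` strictly dominates `|g|`, together with the origin,
form a normal cone. -/
theorem isNormalCone_insert_zero_abs_lt {m : ℕ} (f g : (Fin m → ℝ) →ₗ[ℝ] ℝ) :
    IsNormalCone (insert 0 {β | |g β| < f β}) := by
  refine ⟨⟨0, Set.mem_insert _ _⟩, ?_, ?_, ?_⟩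
  · rintro u (rfl | hu) v (rfl | hv)
    · simp
    · simpa using Or.inr hv
    · simpa using Or.inr hu
    · refine Or.inr ?_
      simp only [Set.mem_ofPred_eq, map_add] at hu hv ⊢
      exact (abs_add_le _ _).trans_lt (add_lt_add hu hv)
  · rintro u (rfl | hu) α hα
    · simp
    · rcases hα.eq_or_lt with rfl | hα
      · simp
      · refine Or.inr ?_
        simp only [Set.mem_ofPred_eq, map_smul, smul_eq_mul, abs_mul, abs_of_pos hα] at hu ⊢
        exact mul_lt_mul_of_pos_left hu hα
  · refine subset_antisymm ?_ (by simp)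
    rintro u ⟨rfl | hu, hu'⟩
    · rfl
    · rcases hu' with hu' | hu'
      · exact neg_eq_zero.1 hu'
      · simp only [Set.mem_ofPred_eq, map_neg, abs_neg] at hu hu'
        linarith [abs_nonneg (g u)]

/-- There is a normal cone `K` such that `interior K ∪ interior (-K)` is exactly the set of
`β ∈ ℝᵐ` with `|Σ βₖ a(k,j)| < |Σ βₖ a(k,i)|`. -/
theorem exists_normalCone (m n : ℕ) (hm : 0 < m) (hn : 0 < n)
    (a : Fin m → Fin n → ℝ)
    (ha : LinearIndependent ℝ fun k => Matrix.diagonal (a k))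
    (i j : Fin n) (hj : j ∉ Sset a i) :
    ∃ K : Set (Fin m → ℝ), IsNormalCone K ∧
      interior K ∪ interior (-K) =
        {β : Fin m → ℝ | |∑ k, β k * a k j| < |∑ k, β k * a k i|} := by
  have : NeZero m := ⟨hm.ne'⟩
  let L : Fin n → (Fin m → ℝ) →ₗ[ℝ] ℝ := fun l => Fintype.linearCombination ℝ fun k => a k l
  have hL : ∀ l β, L l β = ∑ k, β k * a k l := fun l β => by
    simp [L, Fintype.linearCombination_apply]
  simp only [← hL]
  set U : Set (Fin m → ℝ) := {β | |L j β| < L i β} with hUdef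
  have hU : IsOpen U := isOpen_lt (L j).continuous_of_finiteDimensional.abs
    (L i).continuous_of_finiteDimensional
  have hdisj : Disjoint U (-U) := by
    refine Set.disjoint_left.2 fun β hβ hβ' => ?_
    simp only [hUdef, Set.mem_neg, Set.mem_ofPred_eq, map_neg, abs_neg] at hβ hβ'
    linarith [abs_nonneg (L j β)]
  refine ⟨insert 0 U, isNormalCone_insert_zero_abs_lt (L i) (L j), ?_⟩
  have hneg : -insert 0 U = insert 0 (-U) := by
    ext β
    simp
  rw [hneg, interior_insert_zero_of_disjoint_neg hU hdisj,
    interior_insert_zero_of_disjoint_neg hU.neg (by simpa using hdisj.symm)]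
  ext β
  simp [hUdef, lt_abs]
end

section
/- Let A₁, …, A_m be linearly independent diagonal matrices in 𝒟ₙ, with A_k having diagonal (a(k,1),…,a(k,n)). For i ∈ {1,…,n} and j ∉ Sᵢ, define K_j^i = { β ∈ ℝᵐ : |Σ_k β_k a(k,j)| < |Σ_k β_k a(k,i)| and Σ_k β_k a(k,i) > 0 } ∪ {0}. Then the i-th component satisfies the *-Property if and only if the set ⋂_{j ∉ Sᵢ} ( interior(K_j^i) ∪ interior(−K_j^i) ) is nonempty (the intersection over the empty index set being all of ℝᵐ). -/
/-- The associated cone `K_j^i` of the `i`-th component with respect to the `j`-th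
component. -/
def Kcone {m n : ℕ} (a : Fin m → Fin n → ℝ) (i j : Fin n) : Set (Fin m → ℝ) :=
  {β : Fin m → ℝ | |∑ k, β k * a k j| < |∑ k, β k * a k i| ∧ 0 < ∑ k, β k * a k i} ∪ {0}

/-- For `m > 0`, the interior of the associated cone is the cone without its apex. -/
theorem mem_interior_Kcone_iff {m n : ℕ} (hm : 0 < m) (a : Fin m → Fin n → ℝ) (i j : Fin n)
    (β : Fin m → ℝ) :
    β ∈ interior (Kcone a i j) ↔
      |∑ k, β k * a k j| < |∑ k, β k * a k i| ∧ 0 < ∑ k, β k * a k i := by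
  constructor
  · intro h
    rcases interior_subset h with h' | rfl
    · exact h'
    exfalso
    have hK : Kcone a i j ∈ nhds (0 : Fin m → ℝ) := mem_interior_iff_mem_nhds.1 h
    have hcone : ∀ᶠ t in nhds (0 : ℝ), Function.const (Fin m) t ∈ Kcone a i j ∧
        Function.const (Fin m) (-t) ∈ Kcone a i j := by
      refine Filter.Eventually.and ?_ ?_
      · have hc : Continuous fun t : ℝ => Function.const (Fin m) t :=
          continuous_pi fun _ => continuous_id
        exact hc.continuousAt.preimage_mem_nhds hK
      · have hc : Continuous fun t : ℝ => Function.const (Fin m) (-t) :=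
          continuous_pi fun _ => continuous_neg
        refine hc.continuousAt.preimage_mem_nhds ?_
        rw [neg_zero]
        exact hK
    obtain ⟨t, ⟨ht₁, ht₂⟩, ht⟩ :=
      ((hcone.filter_mono nhdsWithin_le_nhds).and
        (self_mem_nhdsWithin : {0}ᶜ ∈ nhdsWithin (0 : ℝ) {0}ᶜ)).exists
    have ht : t ≠ 0 := ht
    have hpos : ∀ s : ℝ, s ≠ 0 → Function.const (Fin m) s ∈ Kcone a i j →
        0 < ∑ k, s * a k i := by
      rintro s hs (hs' | hs')
      · exact hs'.2
      · exact absurd (congrFun hs' ⟨0, hm⟩) hs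
    have h₁ := hpos t ht ht₁
    have h₂ := hpos (-t) (neg_ne_zero.2 ht) ht₂
    simp only [neg_mul, Finset.sum_neg_distrib] at h₂
    linarith
  · intro h
    have hopen : IsOpen {β : Fin m → ℝ |
        |∑ k, β k * a k j| < |∑ k, β k * a k i| ∧ 0 < ∑ k, β k * a k i} := by
      rw [Set.ofPred_and]
      exact (isOpen_lt (by fun_prop) (by fun_prop)).inter (isOpen_lt (by fun_prop) (by fun_prop))
    exact interior_maximal Set.subset_union_left hopen h

/-- For `m > 0`, the interiors of the associated pair of cones are cut out by the strict
inequality of the `*`-Property. -/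
theorem mem_interior_Kcone_union_neg_iff {m n : ℕ} (hm : 0 < m) (a : Fin m → Fin n → ℝ)
    (i j : Fin n) (β : Fin m → ℝ) :
    β ∈ interior (Kcone a i j) ∪ interior (-(Kcone a i j)) ↔
      |∑ k, β k * a k j| < |∑ k, β k * a k i| := by
  have hneg : interior (-(Kcone a i j)) = -interior (Kcone a i j) :=
    ((Homeomorph.neg (Fin m → ℝ)).preimage_interior _).symm
  rw [Set.mem_union, hneg, Set.mem_neg, mem_interior_Kcone_iff hm, mem_interior_Kcone_iff hm]
  simp only [Pi.neg_apply, neg_mul, Finset.sum_neg_distrib, abs_neg, ← and_or_left,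
    Left.neg_pos_iff, and_iff_left_iff_imp]
  intro h
  exact (abs_pos.1 ((abs_nonneg _).trans_lt h)).lt_or_gt.symm

/-- If all components are equivalent to the `i`-th one, then the `i`-th one is nonzero. -/
theorem comp_ne_zero_of_forall_mem_Sset {m n : ℕ} (hm : 0 < m) {a : Fin m → Fin n → ℝ}
    (ha : LinearIndependent ℝ fun k => Matrix.diagonal (a k)) {i : Fin n}
    (hS : ∀ j, j ∈ Sset a i) : comp a i ≠ 0 := by
  intro h0
  refine ha.ne_zero ⟨0, hm⟩ (Matrix.diagonal_eq_zero.2 (funext fun j => ?_))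
  have hj : comp a j = 0 := by
    rcases hS j with hj | hj
    · exact Eq.trans hj h0
    · exact Eq.trans hj (by rw [h0, neg_zero])
  exact congrFun hj ⟨0, hm⟩

/-- Geometric characterization of the `*`-Property via the associated pairs of cones. -/
theorem starProperty_iff_cones (m n : ℕ) (hm : 0 < m) (hn : 0 < n)
    (a : Fin m → Fin n → ℝ)
    (ha : LinearIndependent ℝ fun k => Matrix.diagonal (a k)) (i : Fin n) :
    StarProperty a i ↔
      (⋂ j ∈ {j : Fin n | j ∉ Sset a i},
        (interior (Kcone a i j) ∪ interior (-(Kcone a i j)))).Nonempty := by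
  simp only [StarProperty, Set.Nonempty, Set.mem_iInter, Set.mem_ofPred_eq,
    mem_interior_Kcone_union_neg_iff hm]
  refine ⟨fun ⟨β, _, hβ⟩ => ⟨β, hβ⟩, fun ⟨β, hβ⟩ => ?_⟩
  by_cases hS : ∀ j, j ∈ Sset a i
  · refine ⟨comp a i, fun h0 => comp_ne_zero_of_forall_mem_Sset hm ha hS ?_,
      fun j hj => absurd (hS j) hj⟩
    exact dotProduct_self_eq_zero.1 h0
  · obtain ⟨j, hj⟩ := not_forall.1 hS
    exact ⟨β, abs_pos.1 ((abs_nonneg _).trans_lt (hβ j hj)), hβ⟩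
end

section
/- Let A₁, …, A_m be linearly independent diagonal matrices in 𝒟ₙ, with A_k having diagonal (a(k,1),…,a(k,n)). If for some i ∈ {1,…,n} the i-th component vector vᵢ does not belong to span{ v_j : 1 ≤ j ≤ n, j ∉ Sᵢ }, then the i-th component satisfies the *-Property. -/
/-- If the `i`-th component does not lie in the span of the components outside `Sᵢ`, then the
`i`-th component satisfies the `*`-Property. -/
theorem starProperty_of_not_mem_span (m n : ℕ) (hm : 0 < m) (hn : 0 < n)
    (a : Fin m → Fin n → ℝ)
    (ha : LinearIndependent ℝ fun k => Matrix.diagonal (a k)) (i : Fin n)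
    (h : comp a i ∉ Submodule.span ℝ (comp a '' {j : Fin n | j ∉ Sset a i})) :
    StarProperty a i := by
  obtain ⟨f, hfi, hf⟩ := Submodule.exists_le_ker_of_notMem h
  have hsum (j : Fin n) : ∑ k, f (Pi.single k 1) * a k j = f (comp a j) := by
    rw [LinearMap.pi_apply_eq_sum_univ f (comp a j)]
    refine Finset.sum_congr rfl fun k _ => ?_
    rw [smul_eq_mul, mul_comm, comp]
    congr 2
    ext l
    simp [Pi.single_apply, eq_comm]
  refine ⟨fun k => f (Pi.single k 1), by simpa only [hsum] using hfi, fun j hj => ?_⟩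
  have hfj : f (comp a j) = 0 := hf (Submodule.subset_span ⟨j, hj, rfl⟩)
  simpa only [hsum, hfj, abs_zero] using abs_pos.mpr hfi
end

section
/- Let A₁, …, A_m be linearly independent diagonal matrices in 𝒟ₙ, with A_k having diagonal (a(k,1),…,a(k,n)). Fix i ∈ {1,…,n} and let 𝒯ᵢ = { j ∈ {1,…,n} : v_j is a scalar multiple of vᵢ or vᵢ is a scalar multiple of v_j }. Assume that for every j ∈ 𝒯ᵢ there exists c_j ∈ ℝ with |c_j| ≥ 1 and vᵢ = c_j v_j, and that vᵢ ∉ span{ v_k : 1 ≤ k ≤ n, k ∉ 𝒯ᵢ }. Then the i-th component satisfies the *-Property. -/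
/-- The set `𝒯ᵢ` of indices whose component is a scalar multiple of the `i`-th component or
vice versa. -/
def Tset {m n : ℕ} (a : Fin m → Fin n → ℝ) (i : Fin n) : Set (Fin n) :=
  {j | (∃ c : ℝ, comp a j = c • comp a i) ∨ ∃ c : ℝ, comp a i = c • comp a j}

/-- If `vᵢ = c_j v_j` with `|c_j| ≥ 1` for every `j ∈ 𝒯ᵢ`, and `vᵢ` is not in the span of the
components outside `𝒯ᵢ`, then the `i`-th component satisfies the `*`-Property. -/
theorem starProperty_of_scalar_multiples (m n : ℕ) (hm : 0 < m) (hn : 0 < n)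
    (a : Fin m → Fin n → ℝ)
    (ha : LinearIndependent ℝ fun k => Matrix.diagonal (a k)) (i : Fin n)
    (hmul : ∀ j ∈ Tset a i, ∃ c : ℝ, 1 ≤ |c| ∧ comp a i = c • comp a j)
    (hspan : comp a i ∉ Submodule.span ℝ (comp a '' {k : Fin n | k ∉ Tset a i})) :
    StarProperty a i := by
  obtain ⟨f, hfi, hf⟩ := Submodule.exists_le_ker_of_notMem hspan
  have hβ (j : Fin n) : ∑ k, f (Pi.single k 1) * a k j = f (comp a j) := by
    rw [f.pi_apply_eq_sum_univ]
    refine Finset.sum_congr rfl fun k _ => ?_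
    have hk : (Pi.single k 1 : Fin m → ℝ) = fun l => if k = l then 1 else 0 := by
      ext l
      simp [Pi.single_apply, eq_comm]
    rw [hk, smul_eq_mul, mul_comm, comp]
  refine ⟨fun k => f (Pi.single k 1), by rwa [hβ], fun j hj => ?_⟩
  rw [hβ, hβ]
  by_cases hT : j ∈ Tset a i
  · obtain ⟨c, hc, hij⟩ := hmul j hT
    have hne : |c| ≠ 1 := by
      intro h
      refine hj ?_
      rcases eq_or_eq_neg_of_abs_eq h with rfl | rfl
      · exact Or.inl (by simp [Pplus, hij])
      · exact Or.inr (by simp [Pminus, hij])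
    have hfij : f (comp a i) = c * f (comp a j) := by rw [hij, map_smul, smul_eq_mul]
    have hfj : f (comp a j) ≠ 0 := fun h => hfi (by rw [hfij, h, mul_zero])
    rw [hfij, abs_mul]
    exact lt_mul_of_one_lt_left (abs_pos.mpr hfj) (lt_of_le_of_ne hc hne.symm)
  · have hfj : f (comp a j) = 0 := hf (Submodule.subset_span ⟨j, hT, rfl⟩)
    rw [hfj, abs_zero]
    exact abs_pos.mpr hfi
end

section
/- Let A₁, …, A_m be linearly independent diagonal matrices in 𝒟ₙ, with A_k having diagonal (a(k,1),…,a(k,n)). Suppose j₁, …, j_r ∈ {1,…,n} are pairwise nonequivalent indices, each of whose components satisfies the *-Property, and such that every index whose component satisfies the *-Property is equivalent to some j_p. Then for any T ∈ Mₙ and any α₁, …, α_m ∈ ℝ, the matrix Σ_k α_k A_k is a best coapproximation to T out of span{A₁, …, A_m} (with respect to the operator norm) if and only if for every p ∈ {1,…,r}: Σ_k α_k a(k, j_p) ∈ W_{j_p}(T). -/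
-- The sign `ε_u`: `1` on `Pᵢ⁺`, `-1` on `Pᵢ⁻`, and `0` elsewhere.
open Classical in
noncomputable def eps {m n : ℕ} (a : Fin m → Fin n → ℝ) (i u : Fin n) : ℝ :=
  if u ∈ Pplus a i then 1 else if u ∈ Pminus a i then -1 else 0

/-- `Wᵢ(T)`, the numerical range of the `*`-associated matrix of `T` corresponding to the
`i`-th component: values `Σ_{u,v} ε_u T_{uv} x_u x_v` over unit vectors `x` supported in `Sᵢ`. -/
def Wset {m n : ℕ} (a : Fin m → Fin n → ℝ) (i : Fin n)
    (T : Matrix (Fin n) (Fin n) ℝ) : Set ℝ :=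
  {w : ℝ | ∃ x : EuclideanSpace ℝ (Fin n), ‖x‖ = 1 ∧ (∀ h ∉ Sset a i, x h = 0) ∧
    w = ∑ u, ∑ v, eps a i u * T u v * x u * x v}

open Filter Topology Finset
open scoped InnerProductSpace Matrix

/-- If `‖B x‖ ≤ c` on the unit sphere and `‖T + N B‖ ≥ s + N c` for all natural `N`, then some unit
vector at which `B` attains the norm `c` satisfies `c s ≤ ⟪T x, B x⟫`. -/
lemma exists_unit_mul_le_inner {E F : Type*} [NormedAddCommGroup E] [NormedSpace ℝ E]
    [FiniteDimensional ℝ E] [Nontrivial E] [NormedAddCommGroup F] [InnerProductSpace ℝ F]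
    (T B : E →L[ℝ] F) {s c : ℝ} (hc : 0 < c) (hB : ∀ x, ‖x‖ = 1 → ‖B x‖ ≤ c)
    (h : ∀ N : ℕ, s + N * c ≤ ‖T + (N : ℝ) • B‖) :
    ∃ x, ‖x‖ = 1 ∧ ‖B x‖ = c ∧ c * s ≤ ⟪T x, B x⟫_ℝ := by
  have hcpt : IsCompact (Metric.sphere (0 : E) 1) := isCompact_sphere 0 1
  have attain (A : E →L[ℝ] F) : ∃ x ∈ Metric.sphere (0 : E) 1, ‖A‖ ≤ ‖A x‖ := by
    obtain ⟨x, hx, hmax⟩ := hcpt.exists_isMaxOn (NormedSpace.sphere_nonempty.2 zero_le_one)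
      (f := fun x => ‖A x‖) (by fun_prop)
    exact ⟨x, hx, A.opNorm_le_of_unit_norm (norm_nonneg _) fun y hy => hmax (by simpa using hy)⟩
  choose x hx hAx using fun N : ℕ => attain (T + (N : ℝ) • B)
  obtain ⟨y, hy, φ, hφ, hlim⟩ := hcpt.tendsto_subseq hx
  have hx1 (N) : ‖x N‖ = 1 := by simpa using hx N
  have hy1 : ‖y‖ = 1 := by simpa using hy
  have hTx (N) : ‖T (x N)‖ ≤ ‖T‖ := by simpa [hx1] using T.le_opNorm (x N)
  have hbound (N) : s + N * c ≤ ‖T (x N) + (N : ℝ) • B (x N)‖ := by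
    simpa using (h N).trans (hAx N)
  have hφ' : Tendsto (fun k => (φ k : ℝ)) atTop atTop :=
    tendsto_natCast_atTop_atTop.comp hφ.tendsto_atTop
  have hnorm : c ≤ ‖B y‖ := by
    have h1 : Tendsto (fun k => (s - ‖T‖) / (φ k : ℝ) + c) atTop (𝓝 (0 + c)) :=
      (hφ'.const_div_atTop _).add_const c
    have h2 : Tendsto (fun k => ‖B (x (φ k))‖) atTop (𝓝 ‖B y‖) :=
      ((by fun_prop : Continuous fun x => ‖B x‖).tendsto y).comp hlim
    rw [zero_add] at h1
    refine le_of_tendsto_of_tendsto h1 h2 ?_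
    filter_upwards [hφ'.eventually_gt_atTop 0] with k hk
    have h3 := (hbound (φ k)).trans (norm_add_le _ _)
    rw [norm_smul, Real.norm_of_nonneg hk.le] at h3
    have h4 := hTx (φ k)
    rw [div_add' _ _ _ hk.ne', div_le_iff₀ hk]
    linarith
  refine ⟨y, hy1, le_antisymm (hB y hy1) hnorm, ?_⟩
  have h1 : Tendsto (fun k => (s ^ 2 - ‖T‖ ^ 2) / 2 / (φ k : ℝ) + c * s) atTop
      (𝓝 (0 + c * s)) := (hφ'.const_div_atTop _).add_const _
  have h2 : Tendsto (fun k => ⟪T (x (φ k)), B (x (φ k))⟫_ℝ) atTop (𝓝 ⟪T y, B y⟫_ℝ) :=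
    ((by fun_prop : Continuous fun x => ⟪T x, B x⟫_ℝ).tendsto y).comp hlim
  rw [zero_add] at h1
  refine le_of_tendsto_of_tendsto h1 h2 ?_
  filter_upwards [hφ'.eventually_gt_atTop 0, hφ'.eventually_ge_atTop (-s / c)] with k hk hk'
  rw [div_le_iff₀ hc] at hk'
  have h3 := pow_le_pow_left₀ (by linarith) (hbound (φ k)) 2
  rw [norm_add_sq_real, norm_smul, Real.norm_of_nonneg hk.le, real_inner_smul_right] at h3
  have h4 := pow_le_pow_left₀ (norm_nonneg _) (hTx (φ k)) 2
  have h5 := pow_le_pow_left₀ (norm_nonneg _) (hB _ (hx1 (φ k))) 2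
  have h6 := mul_le_mul_of_nonneg_left h5 (sq_nonneg (φ k : ℝ))
  rw [div_add' _ _ _ hk.ne', div_le_iff₀ hk]
  nlinarith

/-- Values of a quadratic form on the unit vectors of a subspace form an interval. -/
lemma exists_unit_eq_of_le_of_le {E : Type*} [NormedAddCommGroup E] [InnerProductSpace ℝ E]
    (A : E →L[ℝ] E) (V : Submodule ℝ E) {x y : E} (hx : x ∈ V) (hy : y ∈ V) (hx1 : ‖x‖ = 1)
    (hy1 : ‖y‖ = 1) {t : ℝ} (hxt : ⟪A x, x⟫_ℝ ≤ t) (hyt : t ≤ ⟪A y, y⟫_ℝ) :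
    ∃ z ∈ V, ‖z‖ = 1 ∧ ⟪A z, z⟫_ℝ = t := by
  by_cases hxy : x = -y
  · refine ⟨y, hy, hy1, le_antisymm ?_ hyt⟩
    simpa [hxy] using hxt
  let z : ℝ → E := fun s => (1 - s) • x + s • y
  have hcont : ContinuousOn (fun s => ⟪A (z s), z s⟫_ℝ - t * ‖z s‖ ^ 2) (Set.Icc 0 1) := by
    fun_prop
  obtain ⟨s, -, hs⟩ := intermediate_value_Icc zero_le_one hcont
    (show (0 : ℝ) ∈ Set.Icc _ _ by simp [z, hx1, hy1, hxt, hyt])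
  have hz : z s ≠ 0 := by
    intro h0
    have h1 : (1 - s) • x = -(s • y) := eq_neg_of_add_eq_zero_left h0
    have h2 := congrArg norm h1
    rw [norm_neg, norm_smul, norm_smul, hx1, hy1, mul_one, mul_one, Real.norm_eq_abs,
      Real.norm_eq_abs, abs_eq_abs] at h2
    have h3 : s = 1 / 2 := by rcases h2 with h2 | h2 <;> linarith
    subst h3
    apply hxy
    have h4 := congrArg (fun v => (2 : ℝ) • v) h1
    norm_num [smul_smul, ← smul_neg] at h4
    exact h4
  have hz' : ‖z s‖ ≠ 0 := norm_ne_zero_iff.2 hz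
  refine ⟨‖z s‖⁻¹ • z s, V.smul_mem _ (V.add_mem (V.smul_mem _ hx) (V.smul_mem _ hy)), ?_, ?_⟩
  · simp [norm_smul, hz']
  · simp only [map_smul, real_inner_smul_left, real_inner_smul_right]
    have hs' : ⟪A (z s), z s⟫_ℝ = t * ‖z s‖ ^ 2 := sub_eq_zero.1 hs
    rw [hs']
    field_simp

/-- Nonzero linear functionals in a finite family are simultaneously nonzero on a dense set. -/
lemma dense_setOf_forall_ne_zero {E ι : Type*} [NormedAddCommGroup E] [NormedSpace ℝ E]
    [CompleteSpace E] [Finite ι] (g : ι → E →L[ℝ] ℝ) :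
    Dense {x | ∀ i, g i ≠ 0 → g i x ≠ 0} := by
  have heq : {x | ∀ i, g i ≠ 0 → g i x ≠ 0} = ⋂ i, {x | g i ≠ 0 → g i x ≠ 0} := by
    ext; simp
  rw [heq]
  refine dense_iInter_of_isOpen (fun i => ?_) (fun i => ?_)
  · by_cases hi : g i = 0
    · simp [hi]
    · simpa [hi] using isOpen_ne_fun (g i).continuous continuous_const
  · by_cases hi : g i = 0
    · simp [hi]
    · have hker : interior (LinearMap.ker (g i : E →ₗ[ℝ] ℝ) : Set E) = ∅ := by
        by_contra h
        have htop := Submodule.eq_top_of_nonempty_interior' _ (Set.nonempty_iff_ne_empty.2 h)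
        refine hi (ContinuousLinearMap.ext fun x => ?_)
        have hx : x ∈ LinearMap.ker (g i : E →ₗ[ℝ] ℝ) := htop ▸ Submodule.mem_top
        simpa using hx
      convert interior_eq_empty_iff_dense_compl.1 hker using 1
      ext x
      simp [hi]

/-- The continuous linear operator on Euclidean space given by a matrix. -/
noncomputable def euclideanOp {n : ℕ} :
    Matrix (Fin n) (Fin n) ℝ →ₗ[ℝ]
      (EuclideanSpace ℝ (Fin n) →L[ℝ] EuclideanSpace ℝ (Fin n)) :=
  LinearMap.toContinuousLinearMap.toLinearMap ∘ₗ Matrix.toEuclideanLin.toLinearMap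

lemma opNorm_eq_norm_euclideanOp {n : ℕ} (A : Matrix (Fin n) (Fin n) ℝ) :
    opNorm A = ‖euclideanOp A‖ := rfl

lemma euclideanOp_apply {n : ℕ} (A : Matrix (Fin n) (Fin n) ℝ) (x : EuclideanSpace ℝ (Fin n))
    (u : Fin n) : euclideanOp A x u = ∑ v, A u v * x v := by
  simp [euclideanOp, Matrix.mulVec, dotProduct]

lemma euclideanOp_diagonal_apply {n : ℕ} (d : Fin n → ℝ) (x : EuclideanSpace ℝ (Fin n))
    (u : Fin n) : euclideanOp (Matrix.diagonal d) x u = d u * x u := by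
  simp [euclideanOp, Matrix.mulVec_diagonal]

lemma norm_euclideanOp_diagonal_apply_sq {n : ℕ} (d : Fin n → ℝ) (x : EuclideanSpace ℝ (Fin n)) :
    ‖euclideanOp (Matrix.diagonal d) x‖ ^ 2 = ∑ u, d u ^ 2 * x u ^ 2 := by
  simp [EuclideanSpace.real_norm_sq_eq, euclideanOp_diagonal_apply, mul_pow]

lemma norm_euclideanOp_diagonal_apply_le {n : ℕ} {d : Fin n → ℝ} {c : ℝ} (hc : 0 ≤ c)
    (hd : ∀ u, |d u| ≤ c) (x : EuclideanSpace ℝ (Fin n)) :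
    ‖euclideanOp (Matrix.diagonal d) x‖ ≤ c * ‖x‖ := by
  refine le_of_sq_le_sq ?_ (by positivity)
  rw [norm_euclideanOp_diagonal_apply_sq, mul_pow, EuclideanSpace.real_norm_sq_eq, mul_sum]
  refine sum_le_sum fun u _ => mul_le_mul_of_nonneg_right ?_ (sq_nonneg _)
  exact sq_le_sq' (abs_le.1 (hd u)).1 (abs_le.1 (hd u)).2

lemma opNorm_diagonal_le {n : ℕ} {d : Fin n → ℝ} {c : ℝ} (hc : 0 ≤ c) (hd : ∀ u, |d u| ≤ c) :
    opNorm (Matrix.diagonal d) ≤ c :=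
  ContinuousLinearMap.opNorm_le_bound _ hc (norm_euclideanOp_diagonal_apply_le hc hd)

lemma abs_le_opNorm_diagonal {n : ℕ} (d : Fin n → ℝ) (u : Fin n) :
    |d u| ≤ opNorm (Matrix.diagonal d) := by
  have h := (euclideanOp (Matrix.diagonal d)).le_opNorm (EuclideanSpace.single u 1)
  have h1 : euclideanOp (Matrix.diagonal d) (EuclideanSpace.single u 1)
      = EuclideanSpace.single u (d u) := by
    ext v
    rw [euclideanOp_diagonal_apply]
    by_cases hv : v = u <;> simp [hv]
  simpa [h1, opNorm_eq_norm_euclideanOp] using h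

/-- Vectors of Euclidean space vanishing off `S`. -/
def euclideanSupported {n : ℕ} (S : Set (Fin n)) : Submodule ℝ (EuclideanSpace ℝ (Fin n)) where
  carrier := {x | ∀ h ∉ S, x h = 0}
  zero_mem' := by simp
  add_mem' hx hy h hh := by simp [hx h hh, hy h hh]
  smul_mem' c x hx h hh := by simp [hx h hh]

section Components

variable {m n : ℕ} (a : Fin m → Fin n → ℝ) (i : Fin n)

/-- The diagonal of `∑ k, β k • diagonal (a k)`. -/
def combo (β : Fin m → ℝ) : Fin n → ℝ := fun u => ∑ k, β k * a k u

lemma sum_smul_diagonal (β : Fin m → ℝ) :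
    ∑ k, β k • Matrix.diagonal (a k) = Matrix.diagonal (combo a β) := by
  ext u v
  by_cases h : u = v <;> simp [Matrix.sum_apply, combo, h]

lemma combo_sub (β γ : Fin m → ℝ) : combo a (β - γ) = combo a β - combo a γ := by
  ext u; simp [combo, sub_mul]

lemma combo_neg (β : Fin m → ℝ) : combo a (-β) = -combo a β := by
  ext u; simp [combo]

lemma combo_smul (c : ℝ) (β : Fin m → ℝ) : combo a (c • β) = c • combo a β := by
  ext u; simp [combo, mul_sum, mul_assoc]

lemma diagonal_combo_neg (β : Fin m → ℝ) :
    Matrix.diagonal (combo a (-β)) = -Matrix.diagonal (combo a β) := by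
  rw [combo_neg, Matrix.diagonal_neg]
  rfl

lemma diagonal_combo_smul (c : ℝ) (β : Fin m → ℝ) :
    Matrix.diagonal (combo a (c • β)) = c • Matrix.diagonal (combo a β) := by
  rw [combo_smul, Matrix.diagonal_smul]

lemma combo_eq_eps_mul {u : Fin n} (hu : u ∈ Sset a i) (β : Fin m → ℝ) :
    combo a β u = eps a i u * combo a β i := by
  by_cases h : u ∈ Pplus a i
  · have h' : ∀ k, a k u = a k i := congrFun h
    simp [eps, h, combo, h']
  · have hm : u ∈ Pminus a i := hu.resolve_left h
    have h' : ∀ k, a k u = -a k i := congrFun hm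
    simp [eps, h, hm, combo, h']

lemma abs_eps_le_one (u : Fin n) : |eps a i u| ≤ 1 := by
  unfold eps
  split_ifs <;> simp

lemma abs_combo_eq_of_equivComp {i u : Fin n} (h : EquivComp a i u) (β : Fin m → ℝ) :
    |combo a β u| = |combo a β i| := by
  rcases h with h | h
  · have h' : ∀ k, a k u = a k i := congrFun h
    simp [combo, h']
  · have h' : ∀ k, a k u = -a k i := congrFun h
    simp [combo, h']

lemma mem_Wset_iff (T : Matrix (Fin n) (Fin n) ℝ) (w : ℝ) :
    w ∈ Wset a i T ↔ ∃ x ∈ euclideanSupported (Sset a i), ‖x‖ = 1 ∧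
      ⟪euclideanOp (Matrix.diagonal (eps a i) * T) x, x⟫_ℝ = w := by
  have hsum (x : EuclideanSpace ℝ (Fin n)) :
      ⟪euclideanOp (Matrix.diagonal (eps a i) * T) x, x⟫_ℝ =
        ∑ u, ∑ v, eps a i u * T u v * x u * x v := by
    simp only [PiLp.inner_apply, euclideanOp_apply, Matrix.diagonal_mul]
    refine sum_congr rfl fun u _ => ?_
    simp only [RCLike.inner_apply, conj_trivial, mul_sum]
    exact sum_congr rfl fun v _ => by ring
  simp only [hsum]
  constructor
  · rintro ⟨x, hx1, hx, hw⟩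
    exact ⟨x, hx, hx1, hw.symm⟩
  · rintro ⟨x, hx, hx1, hw⟩
    exact ⟨x, hx1, hx, hw.symm⟩

lemma inner_euclideanOp_diagonal_mul (d : Fin n → ℝ) (T : Matrix (Fin n) (Fin n) ℝ)
    (x y : EuclideanSpace ℝ (Fin n)) :
    ⟪euclideanOp (Matrix.diagonal d * T) x, y⟫_ℝ =
      ⟪euclideanOp T x, euclideanOp (Matrix.diagonal d) y⟫_ℝ := by
  simp only [PiLp.inner_apply, euclideanOp_diagonal_apply, RCLike.inner_apply, conj_trivial]
  simp only [euclideanOp_apply, Matrix.diagonal_mul]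
  refine sum_congr rfl fun u _ => ?_
  simp only [mul_sum]
  exact sum_congr rfl fun v _ => by ring

lemma euclideanOp_combo_eq_smul {x : EuclideanSpace ℝ (Fin n)}
    (hx : x ∈ euclideanSupported (Sset a i)) (β : Fin m → ℝ) :
    euclideanOp (Matrix.diagonal (combo a β)) x =
      combo a β i • euclideanOp (Matrix.diagonal (eps a i)) x := by
  ext u
  simp only [euclideanOp_diagonal_apply, PiLp.smul_apply, smul_eq_mul]
  by_cases hu : u ∈ Sset a i
  · rw [combo_eq_eps_mul a i hu]; ring
  · simp [hx u hu]

lemma neg_mem_Wset_neg {T : Matrix (Fin n) (Fin n) ℝ} {w : ℝ} (hw : w ∈ Wset a i (-T)) :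
    -w ∈ Wset a i T := by
  rw [mem_Wset_iff] at hw ⊢
  obtain ⟨x, hx, hx1, rfl⟩ := hw
  exact ⟨x, hx, hx1, by simp⟩

variable {a i}

lemma StarProperty.exists_pos (h : StarProperty a i) :
    ∃ β, 0 < combo a β i ∧ ∀ u ∉ Sset a i, |combo a β u| < combo a β i := by
  obtain ⟨β, h0, hβ⟩ := h
  change combo a β i ≠ 0 at h0
  change ∀ u ∉ Sset a i, |combo a β u| < |combo a β i| at hβ
  rcases h0.lt_or_gt with h0 | h0
  · refine ⟨-β, by simpa [combo_neg] using h0, fun u hu => ?_⟩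
    simpa [combo_neg, abs_of_neg h0] using hβ u hu
  · exact ⟨β, h0, fun u hu => by simpa [abs_of_pos h0] using hβ u hu⟩

lemma exists_mem_Wset_ge (hi : StarProperty a i) (T : Matrix (Fin n) (Fin n) ℝ) (α : Fin m → ℝ)
    (h : ∀ β, |combo a (α - β) i| ≤ opNorm (T - Matrix.diagonal (combo a β))) :
    ∃ w ∈ Wset a i T, combo a α i ≤ w := by
  obtain ⟨β, hpos, hβ⟩ := hi.exists_pos
  have : Nonempty (Fin n) := ⟨i⟩
  have hle (u) : |combo a β u| ≤ combo a β i := by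
    by_cases hu : u ∈ Sset a i
    · rw [combo_eq_eps_mul a i hu, abs_mul, abs_of_pos hpos]
      exact mul_le_of_le_one_left hpos.le (abs_eps_le_one a i u)
    · exact (hβ u hu).le
  obtain ⟨x, hx1, hBx, hinner⟩ := exists_unit_mul_le_inner (euclideanOp T)
    (euclideanOp (Matrix.diagonal (combo a β))) (s := combo a α i) hpos
    (fun x hx => by simpa [hx] using norm_euclideanOp_diagonal_apply_le hpos.le hle x)
    (fun N => by
      have h1 := (le_abs_self _).trans (h (-((N : ℝ) • β)))
      rw [diagonal_combo_neg, diagonal_combo_smul, combo_sub, combo_neg, combo_smul] at h1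
      simpa [opNorm_eq_norm_euclideanOp] using h1)
  have hx : x ∈ euclideanSupported (Sset a i) := by
    have h0 : ∑ u, (combo a β i ^ 2 - combo a β u ^ 2) * x u ^ 2 = 0 := by
      have h1 := norm_euclideanOp_diagonal_apply_sq (combo a β) x
      have h2 := EuclideanSpace.real_norm_sq_eq x
      rw [hBx] at h1
      rw [hx1] at h2
      simp only [sub_mul, sum_sub_distrib, ← mul_sum, ← h1, ← h2]
      ring
    have hnonneg (u) : 0 ≤ (combo a β i ^ 2 - combo a β u ^ 2) * x u ^ 2 :=
      mul_nonneg (sub_nonneg.2 (sq_le_sq' (abs_le.1 (hle u)).1 (abs_le.1 (hle u)).2)) (sq_nonneg _)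
    intro u hu
    have h1 := (sum_eq_zero_iff_of_nonneg fun u _ => hnonneg u).1 h0 u (mem_univ u)
    have h2 := abs_lt.1 (hβ u hu)
    have h3 := sq_lt_sq' h2.1 h2.2
    simpa [(sub_pos.2 h3).ne'] using h1
  refine ⟨_, (mem_Wset_iff a i T _).2 ⟨x, hx, hx1, rfl⟩, ?_⟩
  rw [euclideanOp_combo_eq_smul a i hx, real_inner_smul_right] at hinner
  rw [inner_euclideanOp_diagonal_mul]
  exact le_of_mul_le_mul_left hinner hpos

lemma combo_mem_Wset (hi : StarProperty a i) (T : Matrix (Fin n) (Fin n) ℝ) (α : Fin m → ℝ)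
    (h : ∀ β, |combo a (α - β) i| ≤ opNorm (T - Matrix.diagonal (combo a β))) :
    combo a α i ∈ Wset a i T := by
  obtain ⟨w, hw, hle⟩ := exists_mem_Wset_ge hi T α h
  obtain ⟨w', hw', hle'⟩ := exists_mem_Wset_ge hi (-T) (-α) fun β => by
    have h1 := h (-β)
    rw [← abs_neg, ← Pi.neg_apply, ← combo_neg] at h1
    rw [opNorm_eq_norm_euclideanOp, ← norm_neg, ← map_neg]
    rw [opNorm_eq_norm_euclideanOp, diagonal_combo_neg] at h1
    convert h1 using 3 <;> congr 1 <;> abel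
  have hw'' := neg_mem_Wset_neg a i hw'
  rw [combo_neg, Pi.neg_apply] at hle'
  rw [mem_Wset_iff] at hw hw'' ⊢
  obtain ⟨x, hx, hx1, rfl⟩ := hw
  obtain ⟨y, hy, hy1, hyw⟩ := hw''
  exact exists_unit_eq_of_le_of_le _ _ hy hx hy1 hx1 (by rw [hyw]; linarith) hle

lemma eps_sq_eq_one {u : Fin n} (hu : u ∈ Sset a i) : eps a i u ^ 2 = 1 := by
  unfold eps
  split_ifs with h1 h2 <;> simp
  exact hu.elim h1 h2

lemma abs_combo_le_of_mem_Wset {T : Matrix (Fin n) (Fin n) ℝ} {α : Fin m → ℝ}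
    (h : combo a α i ∈ Wset a i T) (β : Fin m → ℝ) :
    |combo a (α - β) i| ≤ opNorm (T - Matrix.diagonal (combo a β)) := by
  obtain ⟨x, hx, hx1, hw⟩ := (mem_Wset_iff a i T _).1 h
  have hself : ⟪euclideanOp (Matrix.diagonal (eps a i)) x,
      euclideanOp (Matrix.diagonal (eps a i)) x⟫_ℝ = 1 := by
    rw [real_inner_self_eq_norm_sq, norm_euclideanOp_diagonal_apply_sq, ← one_pow 2, ← hx1,
      EuclideanSpace.real_norm_sq_eq]
    refine sum_congr rfl fun u _ => ?_
    by_cases hu : u ∈ Sset a i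
    · rw [eps_sq_eq_one hu, one_mul]
    · simp [hx u hu]
  set y := euclideanOp (Matrix.diagonal (eps a i)) x
  have hy1 : ‖y‖ = 1 := by
    rw [real_inner_self_eq_norm_sq] at hself
    nlinarith [norm_nonneg y]
  have heq : combo a (α - β) i = ⟪euclideanOp (T - Matrix.diagonal (combo a β)) x, y⟫_ℝ := by
    rw [map_sub, sub_apply, inner_sub_left,
      euclideanOp_combo_eq_smul a i hx, real_inner_smul_left, hself,
      ← inner_euclideanOp_diagonal_mul, hw, combo_sub, Pi.sub_apply, mul_one]
  rw [heq, opNorm_eq_norm_euclideanOp]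
  refine (abs_real_inner_le_norm _ _).trans ?_
  simpa [hy1, hx1] using (euclideanOp (T - Matrix.diagonal (combo a β))).le_opNorm x

/-- On a dense set of coefficients, either the combination of diagonals vanishes or its sup norm is
attained at a component with the `*`-Property. -/
lemma dense_setOf_exists_starProperty [Nonempty (Fin n)] (a : Fin m → Fin n → ℝ) :
    Dense {γ : Fin m → ℝ | ∃ i, (∀ u, |combo a γ u| ≤ |combo a γ i|) ∧
      (combo a γ i = 0 ∨ StarProperty a i)} := by
  let f (u : Fin n) : (Fin m → ℝ) →L[ℝ] ℝ := ∑ k, a k u • ContinuousLinearMap.proj k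
  have hf (u γ) : f u γ = combo a γ u := by simp [f, combo, mul_comm]
  let g (q : Fin n × Fin n) : Bool → ((Fin m → ℝ) →L[ℝ] ℝ)
    | true => f q.1 - f q.2
    | false => f q.1 + f q.2
  have hsingle (u : Fin n) (k : Fin m) : f u (Pi.single k 1) = a k u := by
    simp [f, Pi.single_apply]
  refine (dense_setOf_forall_ne_zero fun q : (Fin n × Fin n) × Bool => g q.1 q.2).mono ?_
  intro γ hγ
  obtain ⟨i, hi⟩ := Finite.exists_max fun u => |combo a γ u|
  refine ⟨i, hi, or_iff_not_imp_left.2 fun h0 => ⟨γ, h0, fun u hu => (hi u).lt_of_ne fun he => ?_⟩⟩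
  rcases abs_eq_abs.1 he with he | he
  · refine hγ ((u, i), true) (fun hg => hu (Or.inl ?_)) (by simp [g, hf, he])
    funext k
    have h1 := congrArg (fun l => l (Pi.single k 1)) hg
    simpa [g, hsingle, sub_eq_zero, comp] using h1
  · refine hγ ((u, i), false) (fun hg => hu (Or.inr ?_)) (by simp [g, hf, he])
    funext k
    have h1 := congrArg (fun l => l (Pi.single k 1)) hg
    simpa [g, hsingle, add_eq_zero_iff_eq_neg, comp] using h1

end Components

lemma continuous_opNorm {n : ℕ} :
    Continuous (opNorm : Matrix (Fin n) (Fin n) ℝ → ℝ) :=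
  continuous_norm.comp (euclideanOp (n := n)).continuous_of_finiteDimensional

/-- Characterization of best coapproximations to `T ∈ Mₙ` out of a subspace of diagonal
matrices, in terms of the `*`-Property and numerical ranges of `*`-associated matrices. -/
theorem best_coapprox_iff_mem_Wset (m n : ℕ) (hm : 0 < m) (hn : 0 < n)
    (a : Fin m → Fin n → ℝ)
    (ha : LinearIndependent ℝ fun k => Matrix.diagonal (a k))
    (r : ℕ) (j : Fin r → Fin n)
    (hstar : ∀ p, StarProperty a (j p))
    (hnoneq : ∀ p q, p ≠ q → ¬ EquivComp a (j p) (j q))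
    (hall : ∀ i : Fin n, StarProperty a i → ∃ p, EquivComp a i (j p))
    (T : Matrix (Fin n) (Fin n) ℝ) (α : Fin m → ℝ) :
    (∀ C ∈ Submodule.span ℝ (Set.range fun k => Matrix.diagonal (a k)),
        opNorm ((∑ k, α k • Matrix.diagonal (a k)) - C) ≤ opNorm (T - C)) ↔
      ∀ p : Fin r, (∑ k, α k * a k (j p)) ∈ Wset a (j p) T := by
  have : Nonempty (Fin n) := ⟨⟨0, hn⟩⟩
  have hspan : (∀ C ∈ Submodule.span ℝ (Set.range fun k => Matrix.diagonal (a k)),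
        opNorm ((∑ k, α k • Matrix.diagonal (a k)) - C) ≤ opNorm (T - C)) ↔
      ∀ β, opNorm (Matrix.diagonal (combo a (α - β))) ≤
        opNorm (T - Matrix.diagonal (combo a β)) := by
    have hdiag (β : Fin m → ℝ) : Matrix.diagonal (combo a (α - β)) =
        Matrix.diagonal (combo a α) - Matrix.diagonal (combo a β) := by
      rw [combo_sub, Matrix.diagonal_sub]
      rfl
    simp [Submodule.mem_span_range_iff_exists_fun, sum_smul_diagonal, hdiag]
  rw [hspan]
  constructor
  · intro h p
    exact combo_mem_Wset (hstar p) T α fun β => (abs_le_opNorm_diagonal _ _).trans (h β)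
  · intro h β
    have hclosed : IsClosed {γ : Fin m → ℝ | opNorm (Matrix.diagonal (combo a γ)) ≤
        opNorm (T - Matrix.diagonal (combo a (α - γ)))} := by
      have hcombo : Continuous (combo a) := by unfold combo; fun_prop
      exact isClosed_le (continuous_opNorm.comp (by fun_prop))
        (continuous_opNorm.comp (by fun_prop))
    have hall' : ∀ γ, opNorm (Matrix.diagonal (combo a γ)) ≤
        opNorm (T - Matrix.diagonal (combo a (α - γ))) := by
      refine fun γ => hclosed.closure_subset_iff.2 ?_ (dense_setOf_exists_starProperty a γ)
      rintro γ ⟨i, hmax, hi⟩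
      refine (opNorm_diagonal_le (abs_nonneg _) hmax).trans ?_
      rcases hi with hi | hi
      · simp [hi, opNorm]
      · obtain ⟨p, hp⟩ := hall i hi
        rw [← abs_combo_eq_of_equivComp a hp]
        simpa using abs_combo_le_of_mem_Wset (h p) (α - γ)
    simpa using hall' (α - β)
end

section
/- Let A₁, …, A_m be linearly independent diagonal matrices in 𝒟ₙ, with A_k having diagonal (a(k,1),…,a(k,n)). Then there exist indices i₁, …, i_m ∈ {1,…,n}, pairwise nonequivalent, such that for each s ∈ {1,…,m} the i_s-th component satisfies the *-Property. (In other words, the number of pairwise nonequivalent components satisfying the *-Property is at least m.) -/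
/-- Cauchy–Schwarz, strict unless the two vectors agree up to sign. -/
theorem abs_dotProduct_lt_of_ne {ι : Type*} [Fintype ι] {v w : ι → ℝ}
    (hle : w ⬝ᵥ w ≤ v ⬝ᵥ v) (h : w ≠ v) (h' : w ≠ -v) : |v ⬝ᵥ w| < v ⬝ᵥ v := by
  have h1 : 0 < (w - v) ⬝ᵥ (w - v) := by
    refine lt_of_le_of_ne (Finset.sum_nonneg fun i _ => mul_self_nonneg _) fun h0 => h ?_
    exact sub_eq_zero.1 (dotProduct_self_eq_zero.1 h0.symm)
  have h2 : 0 < (w + v) ⬝ᵥ (w + v) := by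
    refine lt_of_le_of_ne (Finset.sum_nonneg fun i _ => mul_self_nonneg _) fun h0 => h' ?_
    exact eq_neg_of_add_eq_zero_left (dotProduct_self_eq_zero.1 h0.symm)
  simp only [sub_dotProduct, dotProduct_sub, add_dotProduct, dotProduct_add,
    dotProduct_comm w v] at h1 h2
  rw [abs_lt]
  constructor <;> linarith

/-- If the linear form `β` is not identically zero on the components, then some component on
which it does not vanish satisfies the `*`-Property. -/
theorem exists_starProperty_of_dotProduct_ne_zero {m n : ℕ} {a : Fin m → Fin n → ℝ}
    {β : Fin m → ℝ} (hβ : ∃ i, β ⬝ᵥ comp a i ≠ 0) :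
    ∃ i, StarProperty a i ∧ β ⬝ᵥ comp a i ≠ 0 := by
  obtain ⟨i₀, hi₀⟩ := hβ
  obtain ⟨i₁, -, hi₁⟩ := Finset.exists_max_image Finset.univ (fun i => |β ⬝ᵥ comp a i|)
    ⟨i₀, Finset.mem_univ _⟩
  obtain ⟨i, hi, hmax⟩ := Finset.exists_max_image
    (Finset.univ.filter fun i => |β ⬝ᵥ comp a i| = |β ⬝ᵥ comp a i₁|)
    (fun i => comp a i ⬝ᵥ comp a i) ⟨i₁, by simp⟩
  simp only [Finset.mem_filter, Finset.mem_univ, true_and, true_implies] at hi hmax hi₁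
  have hpos : 0 < |β ⬝ᵥ comp a i| := by
    rw [hi]
    exact (abs_pos.2 hi₀).trans_le (hi₁ i₀)
  have hnn : 0 ≤ comp a i ⬝ᵥ comp a i := Finset.sum_nonneg fun k _ => mul_self_nonneg _
  refine ⟨i, ?_, abs_pos.1 hpos⟩
  obtain ⟨s, hs, hsi⟩ : ∃ s : ℝ, |s| = 1 ∧ s * (β ⬝ᵥ comp a i) = |β ⬝ᵥ comp a i| := by
    rcases abs_choice (β ⬝ᵥ comp a i) with h | h
    · exact ⟨1, by simp, by rw [h, one_mul]⟩
    · exact ⟨-1, by simp, by rw [h, neg_one_mul]⟩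
  have key : ∀ j, ∀ᶠ ε : ℝ in nhdsWithin 0 (Set.Ioi 0), j ∉ Sset a i →
      |β ⬝ᵥ comp a j| + ε * |comp a i ⬝ᵥ comp a j| <
        |β ⬝ᵥ comp a i| + ε * (comp a i ⬝ᵥ comp a i) := by
    intro j
    rcases (hi ▸ hi₁ j : |β ⬝ᵥ comp a j| ≤ |β ⬝ᵥ comp a i|).lt_or_eq with h | h
    · refine Filter.Eventually.mono (nhdsWithin_le_nhds ?_) fun ε hε _ => hε
      exact ContinuousAt.eventually_lt (by fun_prop) (by fun_prop) (by simpa using h)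
    · filter_upwards [self_mem_nhdsWithin] with ε hε hj
      rw [h]
      have := abs_dotProduct_lt_of_ne (hmax j (h.trans hi)) (fun h => hj (Or.inl h))
        (fun h => hj (Or.inr h))
      gcongr
  obtain ⟨ε, hε, hε0⟩ := ((Filter.eventually_all.2 key).and self_mem_nhdsWithin).exists
  replace hε0 : 0 < ε := hε0
  have hval : (s • β + ε • comp a i) ⬝ᵥ comp a i =
      |β ⬝ᵥ comp a i| + ε * (comp a i ⬝ᵥ comp a i) := by
    rw [add_dotProduct, smul_dotProduct, smul_dotProduct, smul_eq_mul, smul_eq_mul, hsi]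
  have hval0 : 0 < (s • β + ε • comp a i) ⬝ᵥ comp a i := by
    rw [hval]
    positivity
  refine ⟨s • β + ε • comp a i, hval0.ne', fun j hj => ?_⟩
  change |(s • β + ε • comp a i) ⬝ᵥ comp a j| < |(s • β + ε • comp a i) ⬝ᵥ comp a i|
  rw [abs_of_pos hval0, hval]
  refine lt_of_le_of_lt ?_ (hε j hj)
  rw [add_dotProduct, smul_dotProduct, smul_dotProduct, smul_eq_mul, smul_eq_mul]
  refine (abs_add_le _ _).trans_eq ?_
  rw [abs_mul, abs_mul, hs, one_mul, abs_of_pos hε0]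

/-- A linear form vanishing on all components of a linearly independent family is zero. -/
theorem eq_zero_of_dotProduct_comp_eq_zero {m n : ℕ} {a : Fin m → Fin n → ℝ}
    (ha : LinearIndependent ℝ fun k => Matrix.diagonal (a k)) {β : Fin m → ℝ}
    (hβ : ∀ i, β ⬝ᵥ comp a i = 0) : β = 0 := by
  refine funext (Fintype.linearIndependent_iff.1 ha β ?_)
  ext i j
  rw [Matrix.sum_apply]
  by_cases hij : i = j
  · subst hij
    simpa [dotProduct, comp] using hβ i
  · simp [hij]

/-- The components satisfying the `*`-Property span `ℝᵐ`. -/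
theorem span_comp_starProperty_eq_top {m n : ℕ} {a : Fin m → Fin n → ℝ}
    (ha : LinearIndependent ℝ fun k => Matrix.diagonal (a k)) :
    Submodule.span ℝ (Set.range fun i : {i // StarProperty a i} => comp a i) = ⊤ := by
  by_contra hne
  obtain ⟨φ, hφ, hker⟩ := Submodule.exists_le_ker_of_lt_top _ (lt_top_iff_ne_top.2 hne)
  obtain ⟨β, rfl⟩ := (dotProductEquiv ℝ (Fin m)).surjective φ
  have hβ : ∃ i, β ⬝ᵥ comp a i ≠ 0 := by
    by_contra! h
    exact hφ (by rw [eq_zero_of_dotProduct_comp_eq_zero ha h, map_zero])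
  obtain ⟨i, hi, hi0⟩ := exists_starProperty_of_dotProduct_ne_zero hβ
  exact hi0 (hker (Submodule.subset_span ⟨⟨i, hi⟩, rfl⟩))

/-- The number of pairwise nonequivalent components satisfying the `*`-Property is at
least `m`. -/
theorem exists_m_nonequivalent_starProperty (m n : ℕ) (hm : 0 < m) (hn : 0 < n)
    (a : Fin m → Fin n → ℝ)
    (ha : LinearIndependent ℝ fun k => Matrix.diagonal (a k)) :
    ∃ f : Fin m → Fin n, (∀ p q, p ≠ q → ¬ EquivComp a (f p) (f q)) ∧
      ∀ p, StarProperty a (f p) := by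
  obtain ⟨κ, e, -, hspan, hli⟩ :=
    exists_linearIndependent' ℝ fun i : {i // StarProperty a i} => comp a i
  rw [span_comp_starProperty_eq_top ha] at hspan
  let b := Module.Basis.mk hli hspan.ge
  let g := (Pi.basisFun ℝ (Fin m)).indexEquiv b
  refine ⟨fun p => e (g p), fun p q hpq h => ?_, fun p => (e (g p)).2⟩
  have hne : g p ≠ g q := g.injective.ne hpq
  have hpair := LinearIndepOn.pair_iff _ hne |>.1 (hli.linearIndepOn (s := {g p, g q}))
  rcases h with h | h
  · have := (hpair 1 (-1) (by simp [h])).1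
    exact one_ne_zero this
  · have := (hpair 1 1 (by simp [h])).1
    exact one_ne_zero this
end

section
/- Let A₁, …, A_m be linearly independent diagonal matrices in 𝒟ₙ, with A_k having diagonal (a(k,1),…,a(k,n)). Then span{A₁, …, A_m} is a coproximinal subspace of Mₙ (i.e., every T ∈ Mₙ admits a best coapproximation out of span{A₁, …, A_m} with respect to the operator norm) if and only if there exist pairwise nonequivalent indices i₁, …, i_m, each of whose components satisfies the *-Property, such that every index whose component satisfies the *-Property is equivalent to some i_s (i.e., there are exactly m nonequivalent components satisfying the *-Property). -/
open Filter Topology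

namespace StarComponents

variable {m n : ℕ} {a : Fin m → Fin n → ℝ}

section OpNorm

open scoped Matrix.Norms.L2Operator

theorem opNorm_eq_norm (A : Matrix (Fin n) (Fin n) ℝ) : opNorm A = ‖A‖ := by
  rw [Matrix.l2_opNorm_def]
  rfl

theorem opNorm_nonneg (A : Matrix (Fin n) (Fin n) ℝ) : 0 ≤ opNorm A := norm_nonneg _

theorem opNorm_diagonal_le_iff (d : Fin n → ℝ) {c : ℝ} (hc : 0 ≤ c) :
    opNorm (Matrix.diagonal d) ≤ c ↔ ∀ j, |d j| ≤ c := by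
  rw [opNorm_eq_norm, Matrix.l2_opNorm_diagonal, pi_norm_le_iff_of_nonneg hc]
  rfl

theorem abs_diag_le_opNorm (T : Matrix (Fin n) (Fin n) ℝ) (i : Fin n) : |T i i| ≤ opNorm T := by
  have h := Matrix.l2_opNorm_mulVec T (EuclideanSpace.single i (1 : ℝ))
  have h' := (PiLp.norm_apply_le (WithLp.toLp 2 (T.mulVec (Pi.single i (1 : ℝ)))) i).trans h
  rw [opNorm_eq_norm]
  simpa using h'

end OpNorm

theorem _root_.EquivComp.abs_dotProduct_eq {i j : Fin n} (h : EquivComp a i j) (β : Fin m → ℝ) :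
    |β ⬝ᵥ comp a j| = |β ⬝ᵥ comp a i| := by
  rcases h with h | h <;> simp [h]

theorem _root_.EquivComp.symm {i j : Fin n} (h : EquivComp a i j) : EquivComp a j i := by
  rcases h with h | h
  · exact Or.inl h.symm
  · exact Or.inr (by simp [h])

theorem _root_.EquivComp.trans {i j k : Fin n} (h : EquivComp a i j) (h' : EquivComp a j k) :
    EquivComp a i k := by
  rcases h with h | h <;> rcases h' with h' | h' <;> simp [EquivComp, h', h]

theorem starProperty_iff {i : Fin n} :
    StarProperty a i ↔ ∃ β : Fin m → ℝ, β ⬝ᵥ comp a i ≠ 0 ∧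
      ∀ j, ¬ EquivComp a i j → |β ⬝ᵥ comp a j| < |β ⬝ᵥ comp a i| :=
  Iff.rfl

theorem _root_.StarProperty.of_equivComp {i j : Fin n} (hi : StarProperty a i) (h : EquivComp a i j) :
    StarProperty a j := by
  obtain ⟨β, h0, hβ⟩ := starProperty_iff.1 hi
  refine starProperty_iff.2 ⟨β, ?_, fun k hk => ?_⟩
  · rwa [← abs_pos, h.abs_dotProduct_eq, abs_pos]
  · rw [h.abs_dotProduct_eq]
    exact hβ k fun hik => hk (h.symm.trans hik)

/-- A vector that is neither `v` nor `-v` and is not longer than `v` has inner product with `v`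
strictly smaller than `v ⬝ᵥ v` in absolute value. -/
theorem abs_dotProduct_lt_dotProduct_self {v w : Fin m → ℝ} (hle : w ⬝ᵥ w ≤ v ⬝ᵥ v)
    (h1 : w ≠ v) (h2 : w ≠ -v) : |v ⬝ᵥ w| < v ⬝ᵥ v := by
  have key : ∀ u : Fin m → ℝ, u ≠ 0 → 0 < u ⬝ᵥ u := fun u hu =>
    lt_of_le_of_ne (Finset.sum_nonneg fun k _ => mul_self_nonneg (u k))
      (Ne.symm (mt dotProduct_self_eq_zero.1 hu))
  have hsub := key (w - v) (sub_ne_zero.2 h1)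
  have hadd := key (w + v) (fun h => h2 (eq_neg_of_add_eq_zero_left h))
  simp only [sub_dotProduct, dotProduct_sub, add_dotProduct, dotProduct_add,
    dotProduct_comm w v] at hsub hadd
  rw [abs_lt]
  constructor <;> linarith

/-- A functional not vanishing on all components attains its maximal absolute value at a
component with the `*`-Property. -/
theorem exists_starProperty_abs_dotProduct_le (β : Fin m → ℝ) {j₀ : Fin n}
    (h0 : β ⬝ᵥ comp a j₀ ≠ 0) :
    ∃ i, StarProperty a i ∧ ∀ j, |β ⬝ᵥ comp a j| ≤ |β ⬝ᵥ comp a i| := by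
  obtain ⟨i₀, -, hi₀⟩ := Finset.exists_max_image Finset.univ (fun j => |β ⬝ᵥ comp a j|)
    ⟨j₀, Finset.mem_univ _⟩
  obtain ⟨i, hiF, hi⟩ := Finset.exists_max_image
    (Finset.univ.filter fun j => |β ⬝ᵥ comp a j| = |β ⬝ᵥ comp a i₀|)
    (fun j => comp a j ⬝ᵥ comp a j) ⟨i₀, by simp⟩
  simp only [Finset.mem_filter, Finset.mem_univ, true_and] at hiF hi
  have hmax : ∀ j, |β ⬝ᵥ comp a j| ≤ |β ⬝ᵥ comp a i| := fun j =>
    (hi₀ j (Finset.mem_univ _)).trans hiF.ge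
  refine ⟨i, ?_, hmax⟩
  set s := β ⬝ᵥ comp a i with hs
  have hspos : 0 < |s| := (abs_pos.2 h0).trans_le (hmax j₀)
  have hev : ∀ j, ¬ EquivComp a i j → ∀ᶠ ε in 𝓝[>] (0 : ℝ),
      |(β + (ε * s) • comp a i) ⬝ᵥ comp a j| < |(β + (ε * s) • comp a i) ⬝ᵥ comp a i| := by
    intro j hj
    simp only [add_dotProduct, smul_dotProduct, smul_eq_mul, ← hs]
    rcases (hmax j).lt_or_eq with hlt | heq
    · apply Filter.Eventually.filter_mono nhdsWithin_le_nhds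
      have hc1 : Continuous fun ε : ℝ =>
          |β ⬝ᵥ comp a j + ε * s * (comp a i ⬝ᵥ comp a j)| := by fun_prop
      have hc2 : Continuous fun ε : ℝ => |s + ε * s * (comp a i ⬝ᵥ comp a i)| := by fun_prop
      exact hc1.continuousAt.eventually_lt hc2.continuousAt (by simpa using hlt)
    · filter_upwards [self_mem_nhdsWithin] with ε hε
      have hε : 0 < ε := hε
      have hw : |comp a i ⬝ᵥ comp a j| < comp a i ⬝ᵥ comp a i :=
        abs_dotProduct_lt_dotProduct_self (hi j (heq.trans hiF))
          (fun h => hj (Or.inl h)) (fun h => hj (Or.inr h))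
      have hself : 0 ≤ comp a i ⬝ᵥ comp a i := (abs_nonneg _).trans hw.le
      calc |β ⬝ᵥ comp a j + ε * s * (comp a i ⬝ᵥ comp a j)|
          ≤ |β ⬝ᵥ comp a j| + |ε * s * (comp a i ⬝ᵥ comp a j)| := abs_add_le _ _
        _ = |s| + ε * |s| * |comp a i ⬝ᵥ comp a j| := by
          rw [heq, abs_mul, abs_mul, abs_of_pos hε]
        _ < |s| + ε * |s| * (comp a i ⬝ᵥ comp a i) := by gcongr
        _ = |s + ε * s * (comp a i ⬝ᵥ comp a i)| := by
          have : s + ε * s * (comp a i ⬝ᵥ comp a i) = s * (1 + ε * (comp a i ⬝ᵥ comp a i)) := by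
            ring
          rw [this, abs_mul, abs_of_nonneg (by positivity : 0 ≤ 1 + ε * (comp a i ⬝ᵥ comp a i))]
          ring
  have hall : ∀ᶠ ε in 𝓝[>] (0 : ℝ), ∀ j, ¬ EquivComp a i j →
      |(β + (ε * s) • comp a i) ⬝ᵥ comp a j| < |(β + (ε * s) • comp a i) ⬝ᵥ comp a i| :=
    eventually_all.2 fun j => by
      by_cases hj : EquivComp a i j
      · simp [hj]
      · filter_upwards [hev j hj] with ε h _ using h
  have hne : ∀ᶠ ε in 𝓝[>] (0 : ℝ), (β + (ε * s) • comp a i) ⬝ᵥ comp a i ≠ 0 := by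
    apply Filter.Eventually.filter_mono nhdsWithin_le_nhds
    simp only [add_dotProduct, smul_dotProduct, smul_eq_mul, ← hs]
    have hc : Continuous fun ε : ℝ => s + ε * s * (comp a i ⬝ᵥ comp a i) := by fun_prop
    exact hc.continuousAt.eventually_ne (by simpa using abs_pos.1 hspos)
  obtain ⟨ε, h1, h2⟩ := (hne.and hall).exists
  exact starProperty_iff.2 ⟨_, h1, h2⟩

/-- The diagonal of a linear combination with coefficients `β`. -/
theorem sum_smul_diagonal (β : Fin m → ℝ) :
    ∑ k, β k • Matrix.diagonal (a k) = Matrix.diagonal fun j => β ⬝ᵥ comp a j := by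
  ext i j
  by_cases h : i = j
  · subst h
    simp [Matrix.sum_apply, dotProduct, comp]
  · simp [Matrix.sum_apply, h]

theorem mem_span_diagonal_iff {B : Matrix (Fin n) (Fin n) ℝ} :
    B ∈ Submodule.span ℝ (Set.range fun k => Matrix.diagonal (a k)) ↔
      ∃ β : Fin m → ℝ, Matrix.diagonal (fun j => β ⬝ᵥ comp a j) = B := by
  simp only [Submodule.mem_span_range_iff_exists_fun, sum_smul_diagonal]

theorem eq_zero_of_forall_starProperty
    (ha : LinearIndependent ℝ fun k => Matrix.diagonal (a k)) {β : Fin m → ℝ}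
    (h : ∀ i, StarProperty a i → β ⬝ᵥ comp a i = 0) : β = 0 := by
  have hzero : ∀ j, β ⬝ᵥ comp a j = 0 := by
    intro j
    by_contra hj
    obtain ⟨i, hi, hmax⟩ := exists_starProperty_abs_dotProduct_le β hj
    exact hj (abs_nonpos_iff.1 ((hmax j).trans (by simp [h i hi])))
  funext k
  refine Fintype.linearIndependent_iff.1 ha β ?_ k
  rw [sum_smul_diagonal]
  simp [hzero]

theorem mul_dotProduct_le_of_forall_abs_dotProduct_lt {b β : Fin m → ℝ} {τ : Fin n → ℝ} {i : Fin n}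
    (hβ : ∀ j, ¬ EquivComp a i j → |β ⬝ᵥ comp a j| < |β ⬝ᵥ comp a i|)
    (hpos : ∀ j, comp a j = comp a i → τ j = τ i)
    (hneg : ∀ j, comp a j = -comp a i → τ j = -τ i)
    (H : ∀ (γ : Fin m → ℝ) (c : ℝ), (∀ j, |τ j - γ ⬝ᵥ comp a j| ≤ c) →
      ∀ j, |b ⬝ᵥ comp a j - γ ⬝ᵥ comp a j| ≤ c) :
    τ i * (β ⬝ᵥ comp a i) ≤ (b ⬝ᵥ comp a i) * (β ⬝ᵥ comp a i) := by
  set s := β ⬝ᵥ comp a i with hs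
  have hev : ∀ᶠ l : ℝ in atTop, ∀ j, |τ j - l * (β ⬝ᵥ comp a j)| ≤ |τ i - l * s| := by
    refine eventually_all.2 fun j => ?_
    by_cases hj : EquivComp a i j
    · refine Eventually.of_forall fun l => le_of_eq ?_
      rcases hj with hj | hj
      · rw [hpos j hj, hj]
      · rw [hneg j hj, hj, dotProduct_neg, ← hs, ← abs_neg]
        congr 1
        ring
    · have hd := sub_pos.2 (hβ j hj)
      filter_upwards [eventually_ge_atTop (0 : ℝ),
        eventually_ge_atTop ((|τ j| + |τ i|) / (|s| - |β ⬝ᵥ comp a j|))] with l hl hl'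
      rw [div_le_iff₀ hd] at hl'
      have e1 : |τ j - l * (β ⬝ᵥ comp a j)| ≤ |τ j| + l * |β ⬝ᵥ comp a j| := by
        simpa [abs_mul, abs_of_nonneg hl] using abs_sub (τ j) (l * (β ⬝ᵥ comp a j))
      have e2 : l * |s| - |τ i| ≤ |τ i - l * s| := by
        rw [abs_sub_comm]
        simpa [abs_mul, abs_of_nonneg hl] using abs_sub_abs_le_abs_sub (l * s) (τ i)
      linarith
  by_contra! hlt
  have hd := sub_pos.2 hlt
  obtain ⟨l, hl, hl'⟩ := (hev.and (eventually_gt_atTop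
    (((τ i) ^ 2 - (b ⬝ᵥ comp a i) ^ 2) / (2 * (τ i * s - b ⬝ᵥ comp a i * s))))).exists
  have hle := H (l • β) |τ i - l * s| (by simpa using hl) i
  simp only [smul_dotProduct, smul_eq_mul, ← hs] at hle
  rw [div_lt_iff₀ (by linarith)] at hl'
  have := sq_le_sq.2 hle
  nlinarith

/-- At a component with the `*`-Property, a best coapproximation of a diagonal matrix whose
entries are compatible with the equivalence of components reproduces the diagonal entry. -/
theorem _root_.StarProperty.dotProduct_eq {b : Fin m → ℝ} {τ : Fin n → ℝ} {i : Fin n}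
    (hi : StarProperty a i)
    (hpos : ∀ j, comp a j = comp a i → τ j = τ i)
    (hneg : ∀ j, comp a j = -comp a i → τ j = -τ i)
    (H : ∀ (γ : Fin m → ℝ) (c : ℝ), (∀ j, |τ j - γ ⬝ᵥ comp a j| ≤ c) →
      ∀ j, |b ⬝ᵥ comp a j - γ ⬝ᵥ comp a j| ≤ c) :
    b ⬝ᵥ comp a i = τ i := by
  obtain ⟨β, h0, hβ⟩ := starProperty_iff.1 hi
  have h1 := mul_dotProduct_le_of_forall_abs_dotProduct_lt hβ hpos hneg H
  have h2 := mul_dotProduct_le_of_forall_abs_dotProduct_lt (β := -β) (by simpa using hβ)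
    hpos hneg H
  simp only [neg_dotProduct] at h2
  exact mul_right_cancel₀ h0 (by linarith)

theorem exists_coapproximation_of_star_representatives
    (ha : LinearIndependent ℝ fun k => Matrix.diagonal (a k)) {f : Fin m → Fin n}
    (hf : ∀ i : Fin n, StarProperty a i → ∃ p, EquivComp a i (f p))
    (T : Matrix (Fin n) (Fin n) ℝ) :
    ∃ B ∈ Submodule.span ℝ (Set.range fun k => Matrix.diagonal (a k)),
      ∀ C ∈ Submodule.span ℝ (Set.range fun k => Matrix.diagonal (a k)),
        opNorm (B - C) ≤ opNorm (T - C) := by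
  let Φ : (Fin m → ℝ) →ₗ[ℝ] (Fin m → ℝ) :=
    Matrix.vecMulLinear (Matrix.of fun k p => a k (f p))
  have hΦ : ∀ β p, Φ β p = β ⬝ᵥ comp a (f p) := fun _ _ => rfl
  have hinj : Function.Injective Φ := by
    rw [← LinearMap.ker_eq_bot, LinearMap.ker_eq_bot']
    intro β hβ
    refine eq_zero_of_forall_starProperty ha fun i hi => ?_
    obtain ⟨p, hp⟩ := hf i hi
    rw [← abs_eq_zero, ← hp.abs_dotProduct_eq, ← hΦ, hβ]
    simp
  obtain ⟨b, hb⟩ := LinearMap.injective_iff_surjective.1 hinj fun p => T (f p) (f p)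
  refine ⟨_, mem_span_diagonal_iff.2 ⟨b, rfl⟩, fun C hC => ?_⟩
  obtain ⟨γ, rfl⟩ := mem_span_diagonal_iff.1 hC
  rw [Matrix.diagonal_sub, opNorm_diagonal_le_iff _ (opNorm_nonneg _)]
  intro j
  simp only [← sub_dotProduct]
  by_cases hj : (b - γ) ⬝ᵥ comp a j = 0
  · simpa [hj] using opNorm_nonneg _
  obtain ⟨i, hi, hmax⟩ := exists_starProperty_abs_dotProduct_le (b - γ) hj
  obtain ⟨p, hp⟩ := hf i hi
  refine ((hmax j).trans_eq (hp.abs_dotProduct_eq _).symm).trans ?_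
  have := abs_diag_le_opNorm (T - Matrix.diagonal fun j => γ ⬝ᵥ comp a j) (f p)
  rwa [Matrix.sub_apply, Matrix.diagonal_apply_eq, ← congrFun hb p, hΦ, ← sub_dotProduct] at this

theorem exists_star_representatives_of_coproximinal
    (ha : LinearIndependent ℝ fun k => Matrix.diagonal (a k))
    (h : ∀ T : Matrix (Fin n) (Fin n) ℝ,
      ∃ B ∈ Submodule.span ℝ (Set.range fun k => Matrix.diagonal (a k)),
        ∀ C ∈ Submodule.span ℝ (Set.range fun k => Matrix.diagonal (a k)),
          opNorm (B - C) ≤ opNorm (T - C)) :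
    ∃ f : Fin m → Fin n, (∀ p q, p ≠ q → ¬ EquivComp a (f p) (f q)) ∧
      (∀ p, StarProperty a (f p)) ∧
      ∀ i : Fin n, StarProperty a i → ∃ p, EquivComp a i (f p) := by
  classical
  let R := {i : Fin n // StarProperty a i ∧ ∀ j, EquivComp a i j → i ≤ j}
  have hR : ∀ i, StarProperty a i → ∃ r : R, EquivComp a i r := by
    intro i hi
    obtain ⟨r, hr, hmin⟩ := Finset.exists_min_image
      (Finset.univ.filter fun j => EquivComp a i j) id
      ⟨i, Finset.mem_filter.2 ⟨Finset.mem_univ _, Or.inl rfl⟩⟩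
    simp only [Finset.mem_filter, Finset.mem_univ, true_and, id] at hr hmin
    exact ⟨⟨r, StarProperty.of_equivComp hi hr, fun j hj => hmin j (hr.trans hj)⟩, hr⟩
  have hRne : ∀ r q : R, EquivComp a r q → r = q := fun r q hrq =>
    Subtype.ext (le_antisymm (r.2.2 _ hrq) (q.2.2 _ hrq.symm))
  let Φ : (Fin m → ℝ) →ₗ[ℝ] (R → ℝ) := Matrix.vecMulLinear (Matrix.of fun k (r : R) => a k r)
  have hΦ : ∀ β r, Φ β r = β ⬝ᵥ comp a r := fun _ _ => rfl
  have hinj : Function.Injective Φ := by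
    rw [← LinearMap.ker_eq_bot, LinearMap.ker_eq_bot']
    intro β hβ
    refine eq_zero_of_forall_starProperty ha fun i hi => ?_
    obtain ⟨r, hr⟩ := hR i hi
    rw [← abs_eq_zero, ← hr.abs_dotProduct_eq, ← hΦ, hβ]
    simp
  have hsurj : Function.Surjective Φ := by
    intro t
    let g : (Fin m → ℝ) → ℝ := Function.extend (fun r : R => comp a r) t 0
    let τ : Fin n → ℝ := fun j => g (comp a j) - g (-comp a j)
    have hτ : ∀ r : R, τ r = t r := by
      intro r
      have h1 : g (comp a r) = t r :=
        Function.Injective.extend_apply (fun q r hqr => hRne q r (Or.inl hqr.symm)) _ _ r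
      have h2 : g (-comp a r) = 0 := by
        refine Function.extend_apply' _ _ _ ?_
        rintro ⟨q, hq⟩
        obtain rfl := hRne r q (Or.inr hq)
        obtain ⟨β, h0, -⟩ := starProperty_iff.1 r.2.1
        exact h0 (by rw [self_eq_neg.1 hq, dotProduct_zero])
      simp [τ, h1, h2]
    obtain ⟨B, hB, hBC⟩ := h (Matrix.diagonal τ)
    obtain ⟨b, rfl⟩ := mem_span_diagonal_iff.1 hB
    refine ⟨b, funext fun r => ?_⟩
    rw [hΦ, ← hτ]
    refine StarProperty.dotProduct_eq r.2.1 (fun j hj => by simp [τ, hj])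
      (fun j hj => by simp [τ, hj]) fun γ c hc j => ?_
    have hc0 : 0 ≤ c := (abs_nonneg _).trans (hc j)
    have hle := hBC _ (mem_span_diagonal_iff.2 ⟨γ, rfl⟩)
    rw [Matrix.diagonal_sub, Matrix.diagonal_sub] at hle
    exact (opNorm_diagonal_le_iff _ hc0).1
      (hle.trans ((opNorm_diagonal_le_iff _ hc0).2 hc)) j
  have hcard : Fintype.card (Fin m) = Fintype.card R := by
    simpa using (LinearEquiv.ofBijective Φ ⟨hinj, hsurj⟩).finrank_eq
  let e : Fin m ≃ R := Fintype.equivOfCardEq hcard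
  refine ⟨fun p => e p, fun p q hpq hE => hpq (e.injective (hRne _ _ hE)),
    fun p => (e p).2.1, fun i hi => ?_⟩
  obtain ⟨r, hr⟩ := hR i hi
  exact ⟨e.symm r, by simpa using hr⟩

end StarComponents

/-- `span{A₁,…,A_m}` is coproximinal in `Mₙ` iff there are exactly `m` pairwise
nonequivalent components satisfying the `*`-Property. -/
theorem coproximinal_iff_exactly_m_starProperty (m n : ℕ) (hm : 0 < m) (hn : 0 < n)
    (a : Fin m → Fin n → ℝ)
    (ha : LinearIndependent ℝ fun k => Matrix.diagonal (a k)) :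
    (∀ T : Matrix (Fin n) (Fin n) ℝ,
        ∃ B ∈ Submodule.span ℝ (Set.range fun k => Matrix.diagonal (a k)),
          ∀ C ∈ Submodule.span ℝ (Set.range fun k => Matrix.diagonal (a k)),
            opNorm (B - C) ≤ opNorm (T - C)) ↔
      ∃ f : Fin m → Fin n, (∀ p q, p ≠ q → ¬ EquivComp a (f p) (f q)) ∧
        (∀ p, StarProperty a (f p)) ∧
        ∀ i : Fin n, StarProperty a i → ∃ p, EquivComp a i (f p) := by
  exact ⟨StarComponents.exists_star_representatives_of_coproximinal ha,
    fun ⟨_, _, _, hf⟩ => StarComponents.exists_coapproximation_of_star_representatives ha hf⟩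
end

section
/- Let Y₁ be the subspace of ℝ⁷ (equipped with the supremum norm ‖x‖_∞ = max_i |x_i|) spanned by the vectors (6, 1, 4, 3, 3, 1, 1), (2, 5, 2, 3, 1, 5, 1), (4, 3, 8, 6, 2, 3, 2) and (2, 1, 4, 9, 1, 1, 3). Then Y₁ is a coproximinal subspace of ℓ_∞⁷: for every x ∈ ℝ⁷ there exists y₀ ∈ Y₁ such that ‖y₀ − y‖_∞ ≤ ‖x − y‖_∞ for all y ∈ Y₁. -/
/-- A vector lies in the span exactly when its last three coordinates are the prescribed multiples
of its first, second and fourth coordinates. -/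
lemma mem_span_iff_coords (x : Fin 7 → ℝ) :
    x ∈ Submodule.span ℝ
        ({![6, 1, 4, 3, 3, 1, 1], ![2, 5, 2, 3, 1, 5, 1],
          ![4, 3, 8, 6, 2, 3, 2], ![2, 1, 4, 9, 1, 1, 3]} : Set (Fin 7 → ℝ)) ↔
      x 4 = x 0 / 2 ∧ x 5 = x 1 ∧ x 6 = x 3 / 3 := by
  simp only [Submodule.mem_span_insert, Submodule.mem_span_singleton]
  constructor
  · rintro ⟨a, _, ⟨b, _, ⟨c, _, ⟨d, rfl⟩, rfl⟩, rfl⟩, rfl⟩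
    simp
    refine ⟨?_, ?_⟩ <;> ring
  · rintro ⟨h4, h5, h6⟩
    refine ⟨(35/144) * x 0 + (-1/18) * x 1 + (-7/72) * x 2 + (-1/216) * x 3, _,
      ⟨(1/36) * x 0 + (2/9) * x 1 + (-1/9) * x 2 + (1/54) * x 3, _,
      ⟨(-1/8) * x 0 + (1/4) * x 2 + (-1/12) * x 3, _,
      ⟨(-1/144) * x 0 + (-1/18) * x 1 + (-7/72) * x 2 + (35/216) * x 3, rfl⟩,
        rfl⟩, rfl⟩, ?_⟩
    ext i
    fin_cases i <;> simp [h4, h5, h6] <;> ring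

/-- The span of `(6,1,4,3,3,1,1), (2,5,2,3,1,5,1), (4,3,8,6,2,3,2), (2,1,4,9,1,1,3)` is a
coproximinal subspace of `ℓ_∞⁷` (here `Fin 7 → ℝ` carries the sup norm). -/
theorem Y1_coproximinal :
    ∀ x : Fin 7 → ℝ,
      ∃ y₀ ∈ Submodule.span ℝ
          ({![6, 1, 4, 3, 3, 1, 1], ![2, 5, 2, 3, 1, 5, 1],
            ![4, 3, 8, 6, 2, 3, 2], ![2, 1, 4, 9, 1, 1, 3]} : Set (Fin 7 → ℝ)),
        ∀ y ∈ Submodule.span ℝ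
            ({![6, 1, 4, 3, 3, 1, 1], ![2, 5, 2, 3, 1, 5, 1],
              ![4, 3, 8, 6, 2, 3, 2], ![2, 1, 4, 9, 1, 1, 3]} : Set (Fin 7 → ℝ)),
          ‖y₀ - y‖ ≤ ‖x - y‖ := by
  intro x
  refine ⟨![x 0, x 1, x 2, x 3, x 0 / 2, x 1, x 3 / 3], ?_, fun y hy ↦ ?_⟩
  · simp [mem_span_iff_coords]
  · obtain ⟨h4, h5, h6⟩ := (mem_span_iff_coords y).1 hy
    have coord_le (i : Fin 7) : |x i - y i| ≤ ‖x - y‖ := norm_le_pi_norm (x - y) i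
    refine (pi_norm_le_iff_of_nonneg (norm_nonneg _)).2 fun i ↦ ?_
    have key0 := abs_le.1 (coord_le 0)
    have key1 := abs_le.1 (coord_le 1)
    have key2 := abs_le.1 (coord_le 2)
    have key3 := abs_le.1 (coord_le 3)
    rw [Real.norm_eq_abs, abs_le]
    fin_cases i <;> simp [h4, h5, h6] <;> constructor <;> linarith
end

section
/- Let Y₂ be the subspace of ℝ⁷ (equipped with the supremum norm ‖x‖_∞ = max_i |x_i|) spanned by the vectors (2, −5, 3, 1, −2, −5, 2) and (−4, 2, 2, −2, −4, 2, −4). Then Y₂ is not a coproximinal subspace of ℓ_∞⁷: there exists x ∈ ℝ⁷ such that no y₀ ∈ Y₂ satisfies ‖y₀ − y‖_∞ ≤ ‖x − y‖_∞ for all y ∈ Y₂. -/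
/-- The span of `(2,−5,3,1,−2,−5,2), (−4,2,2,−2,−4,2,−4)` is not a coproximinal subspace of
`ℓ_∞⁷` (here `Fin 7 → ℝ` carries the sup norm). -/
theorem Y2_not_coproximinal :
    ∃ x : Fin 7 → ℝ,
      ¬ ∃ y₀ ∈ Submodule.span ℝ
            ({![2, -5, 3, 1, -2, -5, 2], ![-4, 2, 2, -2, -4, 2, -4]} : Set (Fin 7 → ℝ)),
          ∀ y ∈ Submodule.span ℝ
              ({![2, -5, 3, 1, -2, -5, 2], ![-4, 2, 2, -2, -4, 2, -4]} : Set (Fin 7 → ℝ)),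
            ‖y₀ - y‖ ≤ ‖x - y‖ := by
  refine ⟨![0, 0, 0, 0, 1, 0, 0], ?_⟩
  rintro ⟨y₀, hy₀, h⟩
  obtain ⟨a, b, rfl⟩ := Submodule.mem_span_pair.1 hy₀
  have key : ∀ (c d r : ℝ), 0 ≤ r →
      ‖(![0, 0, 0, 0, 1, 0, 0] : Fin 7 → ℝ) - (c • ![2, -5, 3, 1, -2, -5, 2] +
        d • ![-4, 2, 2, -2, -4, 2, -4])‖ ≤ r →
      ∀ i : Fin 7, |(a • (![2, -5, 3, 1, -2, -5, 2] : Fin 7 → ℝ) + b • ![-4, 2, 2, -2, -4, 2, -4] -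
        (c • ![2, -5, 3, 1, -2, -5, 2] + d • ![-4, 2, 2, -2, -4, 2, -4]) : Fin 7 → ℝ) i| ≤ r := by
    intro c d r hr hx
    exact (pi_norm_le_iff_of_nonneg hr).1
      ((h _ (Submodule.mem_span_pair.2 ⟨c, d, rfl⟩)).trans hx)
  have bound : ∀ (c d r : ℝ), 0 ≤ r → |2 * c - 4 * d| ≤ r → |-5 * c + 2 * d| ≤ r →
      |3 * c + 2 * d| ≤ r → |1 + 2 * c + 4 * d| ≤ r →
      ‖(![0, 0, 0, 0, 1, 0, 0] : Fin 7 → ℝ) - (c • ![2, -5, 3, 1, -2, -5, 2] +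
        d • ![-4, 2, 2, -2, -4, 2, -4])‖ ≤ r := by
    intro c d r hr h₁ h₂ h₃ h₅
    rw [pi_norm_le_iff_of_nonneg hr]
    rw [abs_le] at h₁ h₂ h₃ h₅
    intro i
    rw [Real.norm_eq_abs, abs_le]
    fin_cases i <;> simp <;> constructor <;> linarith
  have h₁ := key 1 (-2) 10 (by norm_num) (bound _ _ _ (by norm_num) (by norm_num [abs_le])
    (by norm_num [abs_le]) (by norm_num [abs_le]) (by norm_num [abs_le])) 0
  have h₂ := key (-1) 2 10 (by norm_num) (bound _ _ _ (by norm_num) (by norm_num [abs_le])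
    (by norm_num [abs_le]) (by norm_num [abs_le]) (by norm_num [abs_le])) 0
  have h₃ := key 1 0 5 (by norm_num) (bound _ _ _ (by norm_num) (by norm_num [abs_le])
    (by norm_num [abs_le]) (by norm_num [abs_le]) (by norm_num [abs_le])) 1
  have h₄ := key (-1) 0 5 (by norm_num) (bound _ _ _ (by norm_num) (by norm_num [abs_le])
    (by norm_num [abs_le]) (by norm_num [abs_le]) (by norm_num [abs_le])) 1
  have h₅ := key (-1) (-2) 9 (by norm_num) (bound _ _ _ (by norm_num) (by norm_num [abs_le])
    (by norm_num [abs_le]) (by norm_num [abs_le]) (by norm_num [abs_le])) 4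
  rw [abs_le] at h₁ h₂ h₃ h₄ h₅
  simp at h₁ h₂ h₃ h₄ h₅
  linarith [h₁.1, h₁.2, h₂.1, h₂.2, h₃.1, h₃.2, h₄.1, h₄.2, h₅.1, h₅.2]
end
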